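/- arXiv:1607.03052 — 2 statements merged into one kernel-verified Lean document; each statement's English description precedes it below -/
import Mathlib

section
/- Let G1 and G2 be nontrivial finite groups and F = G1 ∗ G2 their free product, and let H1 be a finitely generated factor-free noncyclic subgroup of F with WN-coefficient σ(H1) = sup { r̄(H1, H2) / (r̄(H1)·r̄(H2)) : H2 a finitely generated factor-free noncyclic subgroup of F }. Then this supremum is attained: there exists a finitely generated factor-free noncyclic subgroup H2* of F such that r̄(H1, H2*) = σ(H1)·r̄(H1)·r̄(H2*). -/
open Monoid

section Defs

variable {F : Type} [Group F]

/-- The conjugate subgroup `t K t⁻¹`. -/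
def conjS (t : F) (K : Subgroup F) : Subgroup F := K.map (MulAut.conj t).toMonoidHom

/-- The rank of a subgroup: the minimal number of generators. -/
noncomputable def rk (H : Subgroup F) : ℕ :=
  sInf {n : ℕ | ∃ S : Finset F, S.card = n ∧ Subgroup.closure (S : Set F) = H}

/-- The reduced rank `r̄(H) = max(r(H) - 1, 0)`. -/
noncomputable def rrk (H : Subgroup F) : ℕ := rk H - 1

/-- The setoid on `F` whose classes are the double cosets `H s K`. -/
def dcSetoid (H K : Subgroup F) : Setoid F where
  r s t := ∃ h ∈ H, ∃ k ∈ K, h * s * k = t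
  iseqv := by
    refine ⟨fun s => ⟨1, H.one_mem, 1, K.one_mem, by group⟩, ?_, ?_⟩
    · rintro s t ⟨h, hh, k, hk, rfl⟩
      exact ⟨h⁻¹, H.inv_mem hh, k⁻¹, K.inv_mem hk, by group⟩
    · rintro s t u ⟨h, hh, k, hk, rfl⟩ ⟨h', hh', k', hk', rfl⟩
      exact ⟨h' * h, H.mul_mem hh' hh, k * k', K.mul_mem hk hk', by group⟩

/-- The reduced rank of the generalized intersection of `H` and `K`:
the sum, over the double cosets `H s K`, of `r̄(H ∩ s K s⁻¹)`
(the summands corresponding to trivial intersections vanish, so this agrees with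
the sum over the double cosets with nontrivial intersection). -/
noncomputable def rrkInter (H K : Subgroup F) : ℕ :=
  finsum fun q : Quotient (dcSetoid H K) => rrk (H ⊓ conjS q.out K)

/-- `H` is not a cyclic subgroup. -/
def Noncyclic (H : Subgroup F) : Prop := ∀ g : F, H ≠ Subgroup.closure {g}

end Defs

section TwoFactors

variable {G1 G2 : Type} [Group G1] [Group G2]

/-- A subgroup of `G1 ∗ G2` is factor-free if it meets every conjugate of each of
the two factors trivially. -/
def FactorFree2 (H : Subgroup (Coprod G1 G2)) : Prop :=
  ∀ s : Coprod G1 G2,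
    H ⊓ conjS s (Coprod.inl : G1 →* Coprod G1 G2).range = ⊥ ∧
    H ⊓ conjS s (Coprod.inr : G2 →* Coprod G1 G2).range = ⊥

/-- The set of ratios `r̄(H1, H2) / (r̄(H1)·r̄(H2))` over all finitely generated
factor-free noncyclic subgroups `H2`; its supremum is the WN-coefficient `σ(H1)`. -/
noncomputable def wnSet (H1 : Subgroup (Coprod G1 G2)) : Set ℝ :=
  {x | ∃ H2 : Subgroup (Coprod G1 G2), H2.FG ∧ FactorFree2 H2 ∧ Noncyclic H2 ∧
    x = (rrkInter H1 H2 : ℝ) / ((rrk H1 : ℝ) * (rrk H2 : ℝ))}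

end TwoFactors

noncomputable section DefectTheory

open scoped Classical

variable {F : Type} [Group F] (K : Bool → Subgroup F)

/-- The type of `K b`-orbits. -/
def Orb (b : Bool) (X : Type) [MulAction F X] : Type := MulAction.orbitRel.Quotient (K b) X

/-- The `K b`-orbit of a point. -/
def orb {X : Type} [MulAction F X] (b : Bool) (x : X) : Orb K b X :=
  Quotient.mk (MulAction.orbitRel (K b) X) x

/-- The number of `K b`-orbits met by a finite set. -/
def orbCount {X : Type} [MulAction F X] (b : Bool) (E : Finset X) : ℕ := (E.image (orb K b)).card

/-- Minus the Euler characteristic of the finite graph with edge set `E`, whose vertices are the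
`K true`-orbits and the `K false`-orbits met by `E`. -/
def defect {X : Type} [MulAction F X] (E : Finset X) : ℤ :=
  (E.card : ℤ) - orbCount K true E - orbCount K false E

/-- The subgroups `K b` act freely. -/
def FreeAct (X : Type) [MulAction F X] : Prop :=
  ∀ b, ∀ g ∈ K b, ∀ x : X, g • x = x → g = 1

variable {K}
variable {X Y : Type} [MulAction F X] [MulAction F Y]

theorem orb_eq {b : Bool} {x y : X} : orb K b x = orb K b y ↔ ∃ g ∈ K b, g • y = x := by
  unfold orb Orb
  rw [Quotient.eq, MulAction.orbitRel_apply, MulAction.mem_orbit_iff]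
  constructor
  · rintro ⟨g, h⟩
    exact ⟨g, g.2, h⟩
  · rintro ⟨g, hg, h⟩
    exact ⟨⟨g, hg⟩, h⟩

theorem orb_smul {b : Bool} {g : F} (hg : g ∈ K b) (x : X) : orb K b (g • x) = orb K b x :=
  orb_eq.2 ⟨g, hg, rfl⟩

theorem orb_map {b : Bool} {φ : X → Y} (hφ : ∀ (g : F) x, φ (g • x) = g • φ x) {x y : X}
    (h : orb K b x = orb K b y) : orb K b (φ x) = orb K b (φ y) := by
  obtain ⟨g, hg, rfl⟩ := orb_eq.1 h
  rw [hφ, orb_smul hg]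

theorem orb_map_iff {b : Bool} {φ : X → Y} (hφ : ∀ (g : F) x, φ (g • x) = g • φ x)
    (hinj : Function.Injective φ) {x y : X} :
    orb K b (φ x) = orb K b (φ y) ↔ orb K b x = orb K b y := by
  refine ⟨fun h => ?_, orb_map hφ⟩
  obtain ⟨g, hg, h⟩ := orb_eq.1 h
  rw [← hφ] at h
  exact orb_eq.2 ⟨g, hg, hinj h⟩

@[simp] theorem defect_empty : defect K (∅ : Finset X) = 0 := by
  simp [defect, orbCount]

theorem card_image_eq_of_iff {α β γ : Type*} [DecidableEq β] [DecidableEq γ]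
    {s : Finset α} {f : α → β} {g : α → γ}
    (h : ∀ x ∈ s, ∀ y ∈ s, f x = f y ↔ g x = g y) : (s.image f).card = (s.image g).card := by
  refine Finset.card_bij' (fun b hb => g (Finset.mem_image.1 hb).choose)
    (fun c hc => f (Finset.mem_image.1 hc).choose) ?_ ?_ ?_ ?_
  · intro b hb
    exact Finset.mem_image_of_mem _ (Finset.mem_image.1 hb).choose_spec.1
  · intro b hb
    exact Finset.mem_image_of_mem _ (Finset.mem_image.1 hb).choose_spec.1
  · intro b hb
    have h1 := (Finset.mem_image.1 hb).choose_spec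
    have hm : g (Finset.mem_image.1 hb).choose ∈ s.image g := Finset.mem_image_of_mem _ h1.1
    have h2 := (Finset.mem_image.1 hm).choose_spec
    exact ((h _ h2.1 _ h1.1).2 h2.2).trans h1.2
  · intro b hb
    have h1 := (Finset.mem_image.1 hb).choose_spec
    have hm : f (Finset.mem_image.1 hb).choose ∈ s.image f := Finset.mem_image_of_mem _ h1.1
    have h2 := (Finset.mem_image.1 hm).choose_spec
    exact ((h _ h2.1 _ h1.1).1 h2.2).trans h1.2

theorem orbCount_image {b : Bool} {φ : X → Y} (hφ : ∀ (g : F) x, φ (g • x) = g • φ x)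
    (hinj : Function.Injective φ) (E : Finset X) :
    orbCount K b (E.image φ) = orbCount K b E := by
  unfold orbCount
  rw [Finset.image_image]
  exact card_image_eq_of_iff fun x _ y _ => orb_map_iff hφ hinj

theorem defect_image {φ : X → Y} (hφ : ∀ (g : F) x, φ (g • x) = g • φ x)
    (hinj : Function.Injective φ) (E : Finset X) : defect K (E.image φ) = defect K E := by
  unfold defect
  rw [orbCount_image hφ hinj, orbCount_image hφ hinj, Finset.card_image_of_injective _ hinj]

theorem orbCount_union [DecidableEq X] {b : Bool} {E E' : Finset X}
    (h : ∀ x ∈ E, ∀ y ∈ E', orb K b x ≠ orb K b y) :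
    orbCount K b (E ∪ E') = orbCount K b E + orbCount K b E' := by
  unfold orbCount
  rw [Finset.image_union, Finset.card_union_of_disjoint]
  rw [Finset.disjoint_left]
  intro q hq hq'
  obtain ⟨x, hx, rfl⟩ := Finset.mem_image.1 hq
  obtain ⟨y, hy, hxy⟩ := Finset.mem_image.1 hq'
  exact h x hx y hy hxy.symm

theorem defect_union [DecidableEq X] {E E' : Finset X}
    (h : ∀ b, ∀ x ∈ E, ∀ y ∈ E', orb K b x ≠ orb K b y) :
    defect K (E ∪ E') = defect K E + defect K E' := by
  have hd : Disjoint E E' := Finset.disjoint_left.2 fun x hx hx' => h true x hx x hx' rfl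
  unfold defect
  rw [orbCount_union (h true), orbCount_union (h false), Finset.card_union_of_disjoint hd]
  push_cast
  ring

theorem orbCount_insert (b : Bool) (E : Finset X) (x : X) :
    orbCount K b (insert x E) =
      orbCount K b E + if ∃ y ∈ E, orb K b y = orb K b x then 0 else 1 := by
  unfold orbCount
  rw [Finset.image_insert, Finset.card_insert_eq_ite]
  simp only [Finset.mem_image]
  split_ifs <;> rfl

theorem defect_insert {E : Finset X} {x : X} (hx : x ∉ E) :
    defect K (insert x E) = defect K E + 1
      - (if ∃ y ∈ E, orb K true y = orb K true x then 0 else 1)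
      - (if ∃ y ∈ E, orb K false y = orb K false x then 0 else 1) := by
  unfold defect
  rw [orbCount_insert, orbCount_insert, Finset.card_insert_of_notMem hx]
  push_cast
  ring

theorem defect_insert_of_both {E : Finset X} {x : X} (hx : x ∉ E)
    (h : ∀ b, ∃ y ∈ E, orb K b y = orb K b x) :
    defect K (insert x E) = defect K E + 1 := by
  rw [defect_insert hx, if_pos (h true), if_pos (h false)]
  ring

theorem defect_insert_of_one {E : Finset X} {x : X} (b : Bool) (hx : x ∉ E)
    (h : ∃ y ∈ E, orb K b y = orb K b x) (h' : ¬ ∃ y ∈ E, orb K (!b) y = orb K (!b) x) :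
    defect K (insert x E) = defect K E := by
  rw [defect_insert hx]
  cases b
  · rw [if_pos h, if_neg (show ¬ ∃ y ∈ E, orb K true y = orb K true x from h')]; ring
  · rw [if_pos h, if_neg (show ¬ ∃ y ∈ E, orb K false y = orb K false x from h')]; ring

theorem defect_le_insert {E : Finset X} {x : X} {b : Bool}
    (h : ∃ y ∈ E, orb K b y = orb K b x) : defect K E ≤ defect K (insert x E) := by
  by_cases hx : x ∈ E
  · rw [Finset.insert_eq_of_mem hx]
  by_cases h' : ∃ y ∈ E, orb K (!b) y = orb K (!b) x
  · rw [defect_insert_of_both hx]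
    · omega
    · intro c
      cases b <;> cases c <;> assumption
  · rw [defect_insert_of_one b hx h h']

theorem defect_insert_le {E : Finset X} {x : X} {b : Bool}
    (h : ¬ ∃ y ∈ E, orb K b y = orb K b x) : defect K (insert x E) ≤ defect K E := by
  have hx : x ∉ E := fun hx => h ⟨x, hx, rfl⟩
  rw [defect_insert hx]
  cases b
  · rw [if_neg h]; split_ifs <;> omega
  · rw [if_neg h]; split_ifs <;> omega

theorem defect_singleton (x : X) : defect K ({x} : Finset X) = -1 := by
  simp [defect, orbCount]

theorem defect_le_union {E : Finset X} (Z : Finset X)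
    (h : ∀ z ∈ Z, ∃ b, ∃ y ∈ E, orb K b y = orb K b z) : defect K E ≤ defect K (E ∪ Z) := by
  induction Z using Finset.induction_on with
  | empty => simp
  | insert z Z hz ih =>
    rw [Finset.union_insert]
    refine (ih fun w hw => h w (Finset.mem_insert_of_mem hw)).trans ?_
    obtain ⟨b, y, hy, hyz⟩ := h z (Finset.mem_insert_self _ _)
    exact defect_le_insert (b := b) ⟨y, Finset.mem_union_left _ hy, hyz⟩

theorem orb_surjective (b : Bool) : Function.Surjective (orb K b : X → Orb K b X) :=
  fun q => Quotient.exists_rep q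

/-- `F` is the internal free product of `K true` and `K false`. -/
def IsFreeProd (K : Bool → Subgroup F) : Prop :=
  (⨆ b, K b = ⊤) ∧ ∀ (P : Type) [Group P] (φ : ∀ b, K b →* P),
    ∃ Φ : F →* P, ∀ b, ∀ g : K b, Φ g = φ b g

theorem iSup_induction_left (hK : ⨆ b, K b = ⊤) {p : F → Prop} (one : p 1)
    (mul : ∀ b, ∀ g ∈ K b, ∀ w, p w → p (g * w)) (w : F) : p w := by
  have hw : w ∈ Subgroup.closure (⋃ b, (K b : Set F)) := by
    rw [← Subgroup.iSup_eq_closure, hK]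
    trivial
  induction hw using Subgroup.closure_induction_left with
  | one => exact one
  | mul_left x hx y _ ih =>
    obtain ⟨b, hb⟩ := Set.mem_iUnion.1 hx
    exact mul b x hb y ih
  | inv_mul_cancel x hx y _ ih =>
    obtain ⟨b, hb⟩ := Set.mem_iUnion.1 hx
    exact mul b x⁻¹ ((K b).inv_mem hb) y ih

/-- The action of `F` on `X × V` twisted by a function `f : X → V`. -/
def shear {V : Type} [AddCommGroup V] (f : X → V) : F →* Equiv.Perm (X × V) where
  toFun g :=
    { toFun := fun p => (g • p.1, p.2 + f (g • p.1) - f p.1)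
      invFun := fun p => (g⁻¹ • p.1, p.2 + f (g⁻¹ • p.1) - f p.1)
      left_inv := fun p => by ext <;> simp
      right_inv := fun p => by ext <;> simp }
  map_one' := by ext p <;> simp
  map_mul' g h := by
    ext p
    · simp [mul_smul]
    · simp only [Equiv.coe_fn_mk, Equiv.Perm.mul_apply, mul_smul]
      abel

theorem exists_cocycle (hK : IsFreeProd K) {V : Type} [AddCommGroup V] (f : Bool → X → V) :
    ∃ D : F → X → V, (∀ w w' x, D (w * w') x = D w' x + D w (w' • x)) ∧
      ∀ b, ∀ g ∈ K b, ∀ x, D g x = f b (g • x) - f b x := by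
  obtain ⟨Φ, hΦ⟩ := hK.2 (Equiv.Perm (X × V)) fun b => (shear (f b)).comp (K b).subtype
  have key : ∀ b, ∀ g ∈ K b, ∀ p, Φ g p = (g • p.1, p.2 + f b (g • p.1) - f b p.1) := by
    intro b g hg p
    have := hΦ b ⟨g, hg⟩
    simp only at this
    rw [this]
    rfl
  have step : ∀ w : F, ∀ p : X × V, Φ w p = (w • p.1, p.2 + (Φ w (p.1, 0)).2) := by
    refine iSup_induction_left hK.1 (by simp) ?_
    intro b g hg w ih p
    rw [map_mul, Equiv.Perm.mul_apply, Equiv.Perm.mul_apply, key b g hg, key b g hg, ih p,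
      ih (p.1, 0)]
    ext
    · simp [mul_smul]
    · simp only [zero_add]
      abel
  refine ⟨fun w x => (Φ w (x, 0)).2, fun w w' x => ?_, fun b g hg x => ?_⟩
  · simp only
    rw [map_mul, Equiv.Perm.mul_apply, step w, step w']
  · simp only
    rw [key b g hg]
    simp

theorem defect_add_one_le_card (hK : IsFreeProd K) {H : Subgroup F} {S : Finset F}
    (hS : Subgroup.closure (S : Set F) = H) {E : Finset (F ⧸ H)} (hE : E.Nonempty) :
    defect K E + 1 ≤ S.card := by
  obtain ⟨e₀, he₀⟩ := hE
  let V := E → ℚ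
  let u : F ⧸ H → V := fun x => if h : x ∈ E then Pi.single ⟨x, h⟩ 1 else 0
  obtain ⟨D, hD, hDK⟩ := exists_cocycle hK (fun b => if b then (0 : F ⧸ H → V) else u)
  let x₀ : F ⧸ H := QuotientGroup.mk 1
  have hx₀ : ∀ w : F, w • x₀ = QuotientGroup.mk w := fun w => by
    simp [x₀, MulAction.Quotient.smul_mk]
  have hx₀H : ∀ h ∈ H, h • x₀ = x₀ := fun h hh => by
    rw [hx₀]
    exact (QuotientGroup.eq.2 (by simpa using hh)).symm
  let T₀ : Finset V := S.image fun s => D s x₀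
  have hD1 : D 1 x₀ = 0 := by
    have := hD 1 1 x₀
    simpa using this
  have hW : ∀ h ∈ H, D h x₀ ∈ Submodule.span ℚ (T₀ : Set V) := by
    intro h hh
    rw [← hS] at hh
    induction hh using Subgroup.closure_induction with
    | mem s hs => exact Submodule.subset_span (Finset.mem_image_of_mem _ hs)
    | one => rw [hD1]; exact Submodule.zero_mem _
    | mul a b ha hb iha ihb =>
      rw [hS] at ha hb
      rw [hD, hx₀H b hb]
      exact Submodule.add_mem _ ihb iha
    | inv a ha iha =>
      rw [hS] at ha
      have := hD a⁻¹ a x₀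
      rw [inv_mul_cancel, hD1, hx₀H a ha] at this
      rw [eq_neg_of_add_eq_zero_right this.symm]
      exact Submodule.neg_mem _ iha
  let p : F ⧸ H → V := fun x => D x.out x₀
  have hp : ∀ b, ∀ g ∈ K b, ∀ x, p (g • x) - p x
      - ((if b then (0 : F ⧸ H → V) else u) (g • x) - (if b then (0 : F ⧸ H → V) else u) x) ∈
        Submodule.span ℚ (T₀ : Set V) := by
    intro b g hg x
    have hx : x = QuotientGroup.mk x.out := (QuotientGroup.out_eq' x).symm
    have hh : (g * x.out)⁻¹ * (g • x).out ∈ H := by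
      rw [← QuotientGroup.eq, QuotientGroup.out_eq']
      conv_rhs => rw [hx]
      rfl
    have h1 := hD (g * x.out) ((g * x.out)⁻¹ * (g • x).out) x₀
    rw [mul_inv_cancel_left, hx₀H _ hh, hD g, hx₀, ← hx, hDK b g hg] at h1
    have h2 := hW _ hh
    convert h2 using 1
    simp only [p, h1]
    abel
  have hp1 : ∀ x y, orb K true x = orb K true y → p x - p y ∈ Submodule.span ℚ (T₀ : Set V) := by
    intro x y h
    obtain ⟨g, hg, rfl⟩ := orb_eq.1 h
    simpa using hp true g hg y
  have hp2 : ∀ x y, orb K false x = orb K false y →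
      (u x - p x) - (u y - p y) ∈ Submodule.span ℚ (T₀ : Set V) := by
    intro x y h
    obtain ⟨g, hg, rfl⟩ := orb_eq.1 h
    have := Submodule.neg_mem _ (hp false g hg y)
    convert this using 1
    simp
    abel
  let rep1 : Orb K true (F ⧸ H) → F ⧸ H := Function.surjInv (orb_surjective true)
  let rep2 : Orb K false (F ⧸ H) → F ⧸ H := Function.surjInv (orb_surjective false)
  have hrep1 : ∀ q, orb K true (rep1 q) = q := Function.surjInv_eq _
  have hrep2 : ∀ q, orb K false (rep2 q) = q := Function.surjInv_eq _
  let T₁ : Finset V := ((E.image (orb K true)).erase (orb K true e₀)).image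
    fun q => p (rep1 q) - p e₀
  let T₂ : Finset V := (E.image (orb K false)).image fun q => (u (rep2 q) - p (rep2 q)) + p e₀
  have hsub : ∀ {A B : Finset V}, A ⊆ B →
      Submodule.span ℚ (A : Set V) ≤ Submodule.span ℚ (B : Set V) :=
    fun h => Submodule.span_mono (by exact_mod_cast h)
  have h0 : T₀ ⊆ T₀ ∪ T₁ ∪ T₂ := fun x hx => by simp [hx]
  have huE : ∀ e ∈ E, u e ∈ Submodule.span ℚ ((T₀ ∪ T₁ ∪ T₂ : Finset V) : Set V) := by
    intro e he
    have e1 : p e - p e₀ ∈ Submodule.span ℚ ((T₀ ∪ T₁ ∪ T₂ : Finset V) : Set V) := by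
      by_cases hq : orb K true e = orb K true e₀
      · exact hsub h0 (hp1 _ _ hq)
      · have h1 := hsub h0 (hp1 e (rep1 (orb K true e)) (hrep1 _).symm)
        have h2 : p (rep1 (orb K true e)) - p e₀ ∈ T₁ := Finset.mem_image_of_mem _
          (Finset.mem_erase.2 ⟨hq, Finset.mem_image_of_mem _ he⟩)
        have h3 : p (rep1 (orb K true e)) - p e₀ ∈
            Submodule.span ℚ ((T₀ ∪ T₁ ∪ T₂ : Finset V) : Set V) :=
          Submodule.subset_span (by simp only [Finset.coe_union]; exact Or.inl (Or.inr h2))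
        simpa using Submodule.add_mem _ h1 h3
    have e2 : u e - p e + p e₀ ∈ Submodule.span ℚ ((T₀ ∪ T₁ ∪ T₂ : Finset V) : Set V) := by
      have h1 := hsub h0 (hp2 e (rep2 (orb K false e)) (hrep2 _).symm)
      have h2 : u (rep2 (orb K false e)) - p (rep2 (orb K false e)) + p e₀ ∈ T₂ :=
        Finset.mem_image_of_mem (fun q => (u (rep2 q) - p (rep2 q)) + p e₀)
          (Finset.mem_image_of_mem _ he)
      have h3 : u (rep2 (orb K false e)) - p (rep2 (orb K false e)) + p e₀ ∈
          Submodule.span ℚ ((T₀ ∪ T₁ ∪ T₂ : Finset V) : Set V) :=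
        Submodule.subset_span (by simp only [Finset.coe_union]; exact Or.inr h2)
      convert Submodule.add_mem _ h1 h3 using 1
      abel
    convert Submodule.add_mem _ e1 e2 using 1
    abel
  have htop : Submodule.span ℚ ((T₀ ∪ T₁ ∪ T₂ : Finset V) : Set V) = ⊤ := by
    rw [eq_top_iff, ← (Pi.basisFun ℚ E).span_eq, Submodule.span_le]
    rintro _ ⟨⟨e, he⟩, rfl⟩
    have := huE e he
    simpa [u, he] using this
  have hcard : E.card ≤ (T₀ ∪ T₁ ∪ T₂).card := by
    have h1 := finrank_span_finset_le_card (R := ℚ) (T₀ ∪ T₁ ∪ T₂)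
    rw [Set.finrank, htop, finrank_top, Module.finrank_fintype_fun_eq_card,
      Fintype.card_coe] at h1
    exact h1
  have c0 : T₀.card ≤ S.card := Finset.card_image_le
  have c1 : T₁.card ≤ orbCount K true E - 1 := by
    refine Finset.card_image_le.trans ?_
    rw [Finset.card_erase_of_mem (Finset.mem_image_of_mem _ he₀)]
    rfl
  have c2 : T₂.card ≤ orbCount K false E := Finset.card_image_le
  have c3 : 0 < orbCount K true E := Finset.card_pos.2 ⟨_, Finset.mem_image_of_mem _ he₀⟩
  have c4 := Finset.card_union_le (T₀ ∪ T₁) T₂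
  have c5 := Finset.card_union_le T₀ T₁
  unfold defect
  omega

/-- A partially equivariant section `p` over `E` of the map `F → X`, `w ↦ w • x₀`,
well defined modulo the subgroup `L` of the stabilizer of `x₀`. -/
structure PartialLift (K : Bool → Subgroup F) (x₀ : X) (E : Finset X) (L : Subgroup F)
    (p : X → F) : Prop where
  base_mem : x₀ ∈ E
  base : p x₀ ∈ L
  proj : ∀ x ∈ E, p x • x₀ = x
  equivariant : ∀ b, ∀ g ∈ K b, ∀ x ∈ E, g • x ∈ E → (p (g • x))⁻¹ * (g * p x) ∈ L
  le : L ≤ MulAction.stabilizer F x₀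

theorem PartialLift.insert (hfree : FreeAct K X) {x₀ : X} {E : Finset X} {L L' : Subgroup F}
    {p : X → F} (hp : PartialLift K x₀ E L p) {x : X} (hx : x ∉ E) (hL : L ≤ L')
    (hL' : L' ≤ MulAction.stabilizer F x₀) {a : F} (ha : a • x₀ = x)
    (h : ∀ b, ∀ g ∈ K b, ∀ y ∈ E, g • y = x → a⁻¹ * (g * p y) ∈ L') :
    PartialLift K x₀ (insert x E) L' (Function.update p x a) where
  base_mem := Finset.mem_insert_of_mem hp.base_mem
  base := by
    rw [Function.update_of_ne (by rintro rfl; exact hx hp.base_mem)]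
    exact hL hp.base
  proj y hy := by
    by_cases hyx : y = x
    · subst hyx
      rw [Function.update_self, ha]
    · rw [Function.update_of_ne hyx]
      exact hp.proj y (Finset.mem_of_mem_insert_of_ne hy hyx)
  equivariant b g hg y hy hgy := by
    by_cases hyx : y = x
    · subst hyx
      by_cases hgx : g • y = y
      · rw [hgx, hfree b g hg y hgx]
        simp [L'.one_mem]
      · rw [Function.update_self, Function.update_of_ne hgx]
        have hgE := Finset.mem_of_mem_insert_of_ne hgy hgx
        have := L'.inv_mem (h b g⁻¹ ((K b).inv_mem hg) _ hgE (by simp))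
        convert this using 1
        group
    · rw [Function.update_of_ne hyx]
      have hyE := Finset.mem_of_mem_insert_of_ne hy hyx
      by_cases hgx : g • y = x
      · rw [hgx, Function.update_self]
        exact h b g hg y hyE hgx
      · rw [Function.update_of_ne hgx]
        exact hL (hp.equivariant b g hg y hyE (Finset.mem_of_mem_insert_of_ne hgy hgx))
  le := hL'

theorem PartialLift.mem_of_smul_eq {x₀ : X} {E : Finset X} {L : Subgroup F} {p : X → F}
    (hp : PartialLift K x₀ E L p) {b : Bool} {g g' : F} (hg : g ∈ K b) (hg' : g' ∈ K b) {y y' : X}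
    (hy : y ∈ E) (hy' : y' ∈ E) (h : g' • y' = g • y) : (g * p y)⁻¹ * (g' * p y') ∈ L := by
  have h1 : (g⁻¹ * g') • y' = y := by rw [mul_smul, h, inv_smul_smul]
  have h2 := hp.equivariant b (g⁻¹ * g') ((K b).mul_mem ((K b).inv_mem hg) hg') y' hy'
    (by rwa [h1])
  rw [h1] at h2
  convert h2 using 1
  group

theorem PartialLift.insert_leaf (hfree : FreeAct K X) {x₀ : X} {E : Finset X} {L : Subgroup F}
    {p : X → F} (hp : PartialLift K x₀ E L p) {b : Bool} {g : F} (hg : g ∈ K b) {y : X}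
    (hy : y ∈ E) (hx : g • y ∉ E)
    (h : ¬ ∃ z ∈ E, orb K (!b) z = orb K (!b) (g • y)) :
    PartialLift K x₀ (Insert.insert (g • y) E) L (Function.update p (g • y) (g * p y)) := by
  refine hp.insert hfree hx le_rfl hp.le (by rw [mul_smul, hp.proj y hy]) ?_
  intro c g' hg' y' hy' hgy
  obtain rfl | rfl : c = b ∨ c = !b := by cases b <;> cases c <;> simp
  · exact hp.mem_of_smul_eq hg hg' hy hy' hgy
  · exact absurd ⟨y', hy', by rw [← hgy, orb_smul hg']⟩ h

/-- A partial lift over `E` modulo a subgroup generated by at most `defect E + 1` elements. -/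
def GoodLift (K : Bool → Subgroup F) (x₀ : X) (E : Finset X) (L : Subgroup F) : Prop :=
  (∃ p, PartialLift K x₀ E L p) ∧
    ∃ S : Finset F, Subgroup.closure (S : Set F) = L ∧ (S.card : ℤ) ≤ defect K E + 1

theorem GoodLift.singleton (hfree : FreeAct K X) (x₀ : X) : GoodLift K x₀ {x₀} ⊥ := by
  refine ⟨⟨fun _ => 1, ?_⟩, ∅, by simp, by simp [defect_singleton]⟩
  refine ⟨by simp, by simp, by simp, ?_, bot_le⟩
  intro b g hg x hx hgx
  rw [Finset.mem_singleton] at hx hgx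
  subst hx
  simp [hfree b g hg x hgx]

theorem GoodLift.insert (hfree : FreeAct K X) {x₀ : X} {E : Finset X} {L : Subgroup F}
    (hL : GoodLift K x₀ E L) {x : X} (hx : x ∉ E) {b : Bool} {y : X} (hy : y ∈ E)
    (hxy : orb K b y = orb K b x) : ∃ L', GoodLift K x₀ (insert x E) L' := by
  obtain ⟨⟨p, hp⟩, S, hS, hcard⟩ := hL
  obtain ⟨g, hg, rfl⟩ := orb_eq.1 hxy.symm
  by_cases h : ∃ z ∈ E, orb K (!b) z = orb K (!b) (g • y)
  · obtain ⟨z, hz, hzx⟩ := h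
    have hd := defect_insert_of_both (K := K) hx (fun c => by
      obtain rfl | rfl : c = b ∨ c = !b := by cases b <;> cases c <;> simp
      · exact ⟨y, hy, hxy⟩
      · exact ⟨z, hz, hzx⟩)
    obtain ⟨g', hg', hgz⟩ := orb_eq.1 hzx.symm
    let t : F := (g * p y)⁻¹ * (g' * p z)
    have ht : t ∈ MulAction.stabilizer F x₀ := by
      rw [MulAction.mem_stabilizer_iff, mul_smul, inv_smul_eq_iff, mul_smul, mul_smul, hp.proj y hy,
        hp.proj z hz, hgz]
    refine ⟨L ⊔ Subgroup.closure {t}, ⟨_, hp.insert hfree hx le_sup_left ?_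
      (a := g * p y) (by rw [mul_smul, hp.proj y hy]) ?_⟩, Insert.insert t S, ?_, ?_⟩
    · refine sup_le hp.le ?_
      rw [Subgroup.closure_le]
      simpa using ht
    · intro c k hk y' hy' hky
      obtain rfl | rfl : c = b ∨ c = !b := by cases b <;> cases c <;> simp
      · exact Subgroup.mem_sup_left (hp.mem_of_smul_eq hg hk hy hy' hky)
      · have h1 : (g' * p z)⁻¹ * (k * p y') ∈ L :=
          hp.mem_of_smul_eq hg' hk hz hy' (by rw [hky, hgz])
        have h2 : t ∈ L ⊔ Subgroup.closure {t} :=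
          Subgroup.mem_sup_right (Subgroup.subset_closure rfl)
        convert Subgroup.mul_mem _ h2 (Subgroup.mem_sup_left h1) using 1
        simp only [t]
        group
    · rw [Finset.coe_insert, Set.insert_eq, Subgroup.closure_union, hS, sup_comm]
    · have := Finset.card_insert_le t S
      rw [hd]
      omega
  · refine ⟨L, ⟨_, hp.insert_leaf hfree hg hy hx h⟩, S, hS, ?_⟩
    rw [defect_insert_of_one b hx ⟨y, hy, hxy⟩ h]
    exact hcard

/-- Inside a finite set, the connected component of a point has a good lift. -/
theorem exists_goodLift_component (hfree : FreeAct K X) {E : Finset X} {x₀ : X} (hx₀ : x₀ ∈ E) :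
    ∃ C ⊆ E, x₀ ∈ C ∧ (∀ b, ∀ x ∈ C, ∀ y ∈ E, orb K b x = orb K b y → y ∈ C) ∧
      ∃ L, GoodLift K x₀ C L := by
  obtain ⟨C, hC, hmax⟩ := Finset.exists_max_image
    (E.powerset.filter fun C => ∃ L, GoodLift K x₀ C L) Finset.card
    ⟨{x₀}, by simpa [hx₀] using ⟨_, GoodLift.singleton hfree x₀⟩⟩
  rw [Finset.mem_filter, Finset.mem_powerset] at hC
  obtain ⟨hCE, L, hL⟩ := hC
  refine ⟨C, hCE, hL.1.choose_spec.base_mem, ?_, L, hL⟩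
  intro b x hx y hy hxy
  by_contra hyC
  have := hmax (insert y C) (by
    rw [Finset.mem_filter, Finset.mem_powerset]
    exact ⟨Finset.insert_subset hy hCE, hL.insert hfree hyC hx hxy⟩)
  rw [Finset.card_insert_of_notMem hyC] at this
  omega

/-- If the defect is bounded on `X`, then point stabilizers are finitely generated, with rank
controlled by the defect. -/
theorem exists_generators_of_bounded (hK : IsFreeProd K)
    (hfree : FreeAct K X) {n : ℤ} (hn : ∀ E : Finset X, defect K E ≤ n) (x₀ : X) :
    ∃ (S : Finset F) (E : Finset X),
      Subgroup.closure (S : Set F) = MulAction.stabilizer F x₀ ∧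
      (∀ x ∈ E, ∃ w : F, w • x₀ = x) ∧ (S.card : ℤ) ≤ defect K E + 1 := by
  obtain ⟨d, ⟨E, L, hL, hd⟩, hmax⟩ := Int.exists_greatest_of_bdd
    (P := fun d => ∃ E L, GoodLift K x₀ E L ∧ defect K E = d)
    ⟨n, by rintro _ ⟨E, L, -, rfl⟩; exact hn E⟩ ⟨_, _, _, GoodLift.singleton hfree x₀, rfl⟩
  obtain ⟨⟨p, hp⟩, S, hS, hcard⟩ := hL
  have key : ∀ w : F, ∃ E' p', PartialLift K x₀ E' L p' ∧ defect K E' = d ∧ w • x₀ ∈ E' ∧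
      (p' (w • x₀))⁻¹ * w ∈ L := by
    refine iSup_induction_left hK.1 ?_ ?_
    · refine ⟨E, p, hp, hd, ?_, ?_⟩
      · rw [one_smul]; exact hp.base_mem
      · rw [one_smul, mul_one]; exact L.inv_mem hp.base
    · rintro b g hg w ⟨E', p', hp', hd', hw, hwL⟩
      rw [mul_smul]
      by_cases hx : g • w • x₀ ∈ E'
      · refine ⟨E', p', hp', hd', hx, ?_⟩
        convert L.mul_mem (hp'.equivariant b g hg _ hw hx) hwL using 1
        group
      · have h : ¬ ∃ z ∈ E', orb K (!b) z = orb K (!b) (g • w • x₀) := by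
          rintro ⟨z, hz, hzx⟩
          have hins := defect_insert_of_both (K := K) hx (fun c => by
            obtain rfl | rfl : c = b ∨ c = !b := by cases b <;> cases c <;> simp
            · exact ⟨_, hw, (orb_smul hg _).symm⟩
            · exact ⟨z, hz, hzx⟩)
          obtain ⟨L', hL'⟩ := GoodLift.insert hfree
            (⟨⟨p', hp'⟩, S, hS, by rw [hd', ← hd]; exact hcard⟩ : GoodLift K x₀ E' L) hx hw
            (orb_smul hg (w • x₀)).symm
          have := hmax _ ⟨_, _, hL', rfl⟩
          omega
        refine ⟨_, _, hp'.insert_leaf hfree hg hw hx h, ?_, Finset.mem_insert_self _ _, ?_⟩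
        · rw [defect_insert_of_one b hx ⟨_, hw, (orb_smul hg _).symm⟩ h, hd']
        · rw [Function.update_self]
          convert hwL using 1
          group
  refine ⟨S, E, ?_, fun x hx => ⟨_, hp.proj x hx⟩, hcard⟩
  rw [hS]
  refine le_antisymm hp.le fun h hh => ?_
  obtain ⟨E', p', hp', -, -, hL⟩ := key h
  have hhx : h • x₀ = x₀ := MulAction.mem_stabilizer_iff.1 hh
  rw [hhx] at hL
  simpa using L.mul_mem hp'.base hL

theorem defect_add_one_le_card_of_stabilizer (hK : IsFreeProd K) {x₀ : X} {S : Finset F}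
    (hS : Subgroup.closure (S : Set F) = MulAction.stabilizer F x₀) {E : Finset X}
    (hE : E.Nonempty) (hx₀ : ∀ x ∈ E, ∃ w : F, w • x₀ = x) : defect K E + 1 ≤ S.card := by
  let φ : F ⧸ MulAction.stabilizer F x₀ → X := MulAction.ofQuotientStabilizer F x₀
  have hφ : ∀ (g : F) x, φ (g • x) = g • φ x := MulAction.ofQuotientStabilizer_smul F x₀
  have hinj : Function.Injective φ := MulAction.injective_ofQuotientStabilizer F x₀
  obtain ⟨E', rfl⟩ : ∃ E' : Finset (F ⧸ MulAction.stabilizer F x₀), E'.image φ = E := by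
    refine ⟨E.preimage φ hinj.injOn, ?_⟩
    ext x
    simp only [Finset.mem_image, Finset.mem_preimage]
    refine ⟨by rintro ⟨y, hy, rfl⟩; exact hy, fun hx => ?_⟩
    obtain ⟨w, rfl⟩ := hx₀ x hx
    exact ⟨QuotientGroup.mk w, hx, rfl⟩
  rw [defect_image hφ hinj]
  exact defect_add_one_le_card hK hS (Finset.image_nonempty.1 hE)

theorem rk_le_card {H : Subgroup F} {S : Finset F} (hS : Subgroup.closure (S : Set F) = H) :
    rk H ≤ S.card :=
  Nat.sInf_le ⟨S, rfl, hS⟩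

theorem exists_card_eq_rk {H : Subgroup F} (hH : H.FG) :
    ∃ S : Finset F, S.card = rk H ∧ Subgroup.closure (S : Set F) = H :=
  Nat.sInf_mem (s := {n : ℕ | ∃ S : Finset F, S.card = n ∧ Subgroup.closure (S : Set F) = H})
    (by obtain ⟨S, hS⟩ := hH; exact ⟨_, S, rfl, hS⟩)

theorem rrk_pos_of_noncyclic {H : Subgroup F} (hH : H.FG) (hnc : Noncyclic H) : 0 < rrk H := by
  obtain ⟨S, hS, hcl⟩ := exists_card_eq_rk hH
  by_contra h
  have h2 : S.card ≤ 1 := by unfold rrk at h; omega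
  rcases Nat.le_one_iff_eq_zero_or_eq_one.1 h2 with h0 | h1
  · rw [Finset.card_eq_zero] at h0
    subst h0
    exact hnc 1 (by rw [← hcl, Subgroup.closure_singleton_one]; simp)
  · obtain ⟨g, rfl⟩ := Finset.card_eq_one.1 h1
    exact hnc g (by rw [← hcl]; simp)

theorem noncyclic_of_rrk_pos {H : Subgroup F} (h : 0 < rrk H) : Noncyclic H := by
  rintro g rfl
  have := rk_le_card (H := Subgroup.closure {g}) (S := {g}) (by simp)
  unfold rrk at h
  simp at this
  omega

theorem defect_le_rrk_stabilizer (hK : IsFreeProd K) {x₀ : X}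
    (hfg : (MulAction.stabilizer F x₀).FG) {E : Finset X}
    (hx₀ : ∀ x ∈ E, ∃ w : F, w • x₀ = x) :
    defect K E ≤ rrk (MulAction.stabilizer F x₀) := by
  rcases E.eq_empty_or_nonempty with rfl | hE
  · simp
  · obtain ⟨S, hS, hcl⟩ := exists_card_eq_rk hfg
    have := defect_add_one_le_card_of_stabilizer hK hcl hE hx₀
    unfold rrk
    omega

theorem stabilizer_fg_of_bounded (hK : IsFreeProd K)
    (hfree : FreeAct K X) {n : ℤ} (hn : ∀ E : Finset X, defect K E ≤ n) (x₀ : X) :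
    (MulAction.stabilizer F x₀).FG := by
  obtain ⟨S, E, hS, -, -⟩ := exists_generators_of_bounded hK hfree hn x₀
  exact ⟨S, hS⟩

theorem exists_rrk_stabilizer_le_defect (hK : IsFreeProd K)
    (hfree : FreeAct K X) {n : ℤ} (hn : ∀ E : Finset X, defect K E ≤ n) (x₀ : X) :
    ∃ E : Finset X, (∀ x ∈ E, ∃ w : F, w • x₀ = x) ∧
      (rrk (MulAction.stabilizer F x₀) : ℤ) ≤ defect K E := by
  obtain ⟨S, E, hS, hE, hcard⟩ := exists_generators_of_bounded hK hfree hn x₀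
  have := rk_le_card hS
  by_cases h : 0 < rrk (MulAction.stabilizer F x₀)
  · refine ⟨E, hE, ?_⟩
    unfold rrk at h ⊢
    omega
  · exact ⟨∅, by simp, by simpa using h⟩

/-- A finite set of maximal defect, all of whose vertices have degree at least two. -/
structure IsCore (K : Bool → Subgroup F) (C : Finset X) : Prop where
  nonempty : C.Nonempty
  max : ∀ E : Finset X, defect K E ≤ defect K C
  two : ∀ b, ∀ x ∈ C, ∃ y ∈ C, y ≠ x ∧ orb K b y = orb K b x

theorem exists_isCore {n : ℤ} (hn : ∀ E : Finset X, defect K E ≤ n) {E₀ : Finset X}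
    (hE₀ : 0 < defect K E₀) : ∃ C : Finset X, IsCore K C := by
  obtain ⟨d, ⟨E₁, hE₁⟩, hmax⟩ := Int.exists_greatest_of_bdd
    (P := fun d => ∃ E : Finset X, defect K E = d)
    ⟨n, by rintro _ ⟨E, rfl⟩; exact hn E⟩ ⟨_, E₀, rfl⟩
  have hex : ∃ m, ∃ E : Finset X, defect K E = d ∧ E.card = m := ⟨_, E₁, hE₁, rfl⟩
  obtain ⟨C, hC, hcard⟩ := Nat.find_spec hex
  have hmax' : ∀ E : Finset X, defect K E ≤ defect K C := fun E => hC ▸ hmax _ ⟨E, rfl⟩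
  refine ⟨C, ?_, hmax', ?_⟩
  · rw [Finset.nonempty_iff_ne_empty]
    rintro rfl
    have := hmax' E₀
    rw [defect_empty] at this
    omega
  · intro b x hx
    by_contra h
    have h1 : defect K (insert x (C.erase x)) ≤ defect K (C.erase x) := by
      refine defect_insert_le (b := b) ?_
      rintro ⟨y, hy, hxy⟩
      exact h ⟨y, Finset.mem_of_mem_erase hy, Finset.ne_of_mem_erase hy, hxy⟩
    rw [Finset.insert_erase hx] at h1
    refine Nat.find_min hex (m := (C.erase x).card) ?_ ⟨_, ?_, rfl⟩
    · rw [← hcard]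
      exact Finset.card_erase_lt_of_mem hx
    · have := hmax' (C.erase x)
      omega

/-- The ball of radius `n` around a finite set. -/
def ball (K : Bool → Subgroup F) [∀ b, Finite (K b)] (C : Finset X) : ℕ → Finset X
  | 0 => C
  | n + 1 => Finset.univ.biUnion fun b : Bool =>
      letI := Fintype.ofFinite (K b)
      Finset.univ.biUnion fun g : K b => (ball K C n).image (g • ·)

theorem mem_ball_succ [∀ b, Finite (K b)] {C : Finset X} {n : ℕ} {x : X} :
    x ∈ ball K C (n + 1) ↔ ∃ b, ∃ y ∈ ball K C n, orb K b y = orb K b x := by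
  simp only [ball, Finset.mem_biUnion, Finset.mem_univ, true_and, Finset.mem_image]
  constructor
  · rintro ⟨b, g, y, hy, rfl⟩
    exact ⟨b, y, hy, (orb_smul g.2 y).symm⟩
  · rintro ⟨b, y, hy, hxy⟩
    obtain ⟨g, hg, rfl⟩ := orb_eq.1 hxy.symm
    exact ⟨b, ⟨g, hg⟩, y, hy, rfl⟩

theorem ball_mono [∀ b, Finite (K b)] {C : Finset X} : Monotone (ball K C) :=
  monotone_nat_of_le_succ fun _ x hx => mem_ball_succ.2 ⟨true, x, hx, rfl⟩

theorem defect_le_ball [∀ b, Finite (K b)] {C : Finset X} (n : ℕ) :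
    defect K C ≤ defect K (ball K C n) := by
  induction n with
  | zero => exact le_rfl
  | succ n ih =>
    refine ih.trans ?_
    have h := defect_le_union (K := K) (E := ball K C n) (ball K C (n + 1))
      fun z hz => mem_ball_succ.1 hz
    rwa [Finset.union_eq_right.2 (ball_mono n.le_succ)] at h

theorem exists_mem_ball [∀ b, Finite (K b)] (hK : ⨆ b, K b = ⊤) {C : Finset X} (hC : C.Nonempty)
    (htrans : ∀ x y : X, ∃ w : F, w • x = y) (x : X) : ∃ n, x ∈ ball K C n := by
  obtain ⟨c, hc⟩ := hC
  obtain ⟨w, rfl⟩ := htrans c x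
  revert w
  refine iSup_induction_left hK ?_ ?_
  · rw [one_smul]
    exact ⟨0, hc⟩
  · rintro b g hg w ⟨n, hn⟩
    refine ⟨n + 1, mem_ball_succ.2 ⟨b, _, hn, ?_⟩⟩
    rw [mul_smul, orb_smul hg]

/-- Distance from a core, decreasing along at most one of the two orbits of each point
outside of the core. -/
theorem exists_height [∀ b, Finite (K b)] (hK : ⨆ b, K b = ⊤) {C : Finset X} (hC : IsCore K C)
    (htrans : ∀ x y : X, ∃ w : F, w • x = y) :
    ∃ h : X → ℕ, (∀ x ∈ C, h x = 0) ∧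
      ∀ x ∉ C, ∃ b, ∀ z, z ≠ x → orb K b z = orb K b x → h x < h z := by
  have hex := exists_mem_ball hK hC.nonempty htrans
  refine ⟨fun x => Nat.find (hex x), fun x hx => (Nat.find_eq_zero _).2 hx, fun x hx => ?_⟩
  obtain ⟨n, hn⟩ : ∃ n, Nat.find (hex x) = n + 1 := by
    refine Nat.exists_eq_succ_of_ne_zero fun h0 => hx ?_
    have := Nat.find_spec (hex x)
    rwa [h0] at this
  have hxn : x ∉ ball K C n := Nat.find_min (hex x) (by omega)
  have hxn' : x ∈ ball K C (n + 1) := hn ▸ Nat.find_spec (hex x)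
  obtain ⟨b, y, hy, hyx⟩ := mem_ball_succ.1 hxn'
  refine ⟨!b, fun z hzx hz => ?_⟩
  by_contra hlt
  simp only at hlt
  have hzn : z ∈ ball K C (n + 1) := ball_mono (by omega) (Nat.find_spec (hex z))
  have hxE : x ∉ ball K C n ∪ {z} := by
    simp only [Finset.mem_union, Finset.mem_singleton, not_or]
    exact ⟨hxn, hzx.symm⟩
  have h1 := defect_insert_of_both (K := K) hxE fun c => by
    obtain rfl | rfl : c = b ∨ c = !b := by cases b <;> cases c <;> simp
    · exact ⟨y, by simp [hy], hyx⟩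
    · exact ⟨z, by simp, hz⟩
  have h2 := defect_le_union (K := K) (E := ball K C n) {z} fun w hw => by
    rw [Finset.mem_singleton] at hw
    subst hw
    exact mem_ball_succ.1 hzn
  have h3 := hC.max (insert x (ball K C n ∪ {z}))
  have h4 := defect_le_ball (K := K) (C := C) n
  omega

theorem defect_le_filter_core [∀ b, Finite (K b)] (hK : ⨆ b, K b = ⊤) (hfree : FreeAct K X)
    {C : Finset X} (hC : IsCore K C) (htrans : ∀ x y : X, ∃ w : F, w • x = y) {π : Y → X}
    (hπ : ∀ (g : F) y, π (g • y) = g • π y) (E : Finset Y) :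
    defect K E ≤ defect K (E.filter fun y => π y ∈ C) := by
  obtain ⟨h, h0, hh⟩ := exists_height hK hC htrans
  induction hn : E.card generalizing E with
  | zero =>
    rw [Finset.card_eq_zero] at hn
    subst hn
    simp
  | succ n ih =>
    by_cases hE : ∀ y ∈ E, π y ∈ C
    · rw [Finset.filter_true_of_mem hE]
    · push Not at hE
      obtain ⟨e, he, hmax⟩ := Finset.exists_max_image (E.filter fun y => π y ∉ C) (h ∘ π)
        (by obtain ⟨y, hy, hyC⟩ := hE; exact ⟨y, by simp [hy, hyC]⟩)
      rw [Finset.mem_filter] at he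
      obtain ⟨b, hb⟩ := hh (π e) he.2
      have hlast : ¬ ∃ y ∈ E.erase e, orb K b y = orb K b e := by
        rintro ⟨y, hy, hye⟩
        obtain ⟨g, hg, rfl⟩ := orb_eq.1 hye
        have hne : π (g • e) ≠ π e := by
          intro heq
          rw [hπ] at heq
          rw [hfree b g hg _ heq, one_smul] at hy
          exact Finset.ne_of_mem_erase hy rfl
        have hlt := hb _ hne (orb_map hπ hye)
        have hnC : π (g • e) ∉ C := fun hC' => by
          rw [h0 _ hC'] at hlt
          omega
        have := hmax (g • e) (Finset.mem_filter.2 ⟨Finset.mem_of_mem_erase hy, hnC⟩)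
        simp only [Function.comp] at this
        omega
      have h1 := defect_insert_le hlast
      rw [Finset.insert_erase he.1] at h1
      refine h1.trans ((ih (E.erase e) ?_).trans ?_)
      · rw [Finset.card_erase_of_mem he.1, hn]
        rfl
      · rw [Finset.filter_erase, Finset.erase_eq_of_notMem]
        simp [he.2]

theorem defect_le_card (E : Finset X) : defect K E ≤ E.card := by
  unfold defect
  omega

theorem exists_defect_le_product_core {X₁ X₂ : Type} [MulAction F X₁] [MulAction F X₂]
    [∀ b, Finite (K b)] (hK : ⨆ b, K b = ⊤)
    (hfree₁ : FreeAct K X₁) (hfree₂ : FreeAct K X₂) {C₁ : Finset X₁} {C₂ : Finset X₂}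
    (hC₁ : IsCore K C₁) (hC₂ : IsCore K C₂) (htrans₁ : ∀ x y : X₁, ∃ w : F, w • x = y)
    (htrans₂ : ∀ x y : X₂, ∃ w : F, w • x = y) (E : Finset (X₁ × X₂)) :
    ∃ E' : Finset (X₁ × X₂), E' ⊆ C₁ ×ˢ C₂ ∧ defect K E ≤ defect K E' := by
  refine ⟨(E.filter fun y => y.1 ∈ C₁).filter fun y => y.2 ∈ C₂, ?_, ?_⟩
  · intro y hy
    simp only [Finset.mem_filter] at hy
    exact Finset.mem_product.2 ⟨hy.1.2, hy.2⟩
  · exact (defect_le_filter_core hK hfree₁ hC₁ htrans₁ (π := Prod.fst) (fun _ _ => rfl) E).trans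
      (defect_le_filter_core hK hfree₂ hC₂ htrans₂ (π := Prod.snd) (fun _ _ => rfl) _)

theorem defect_product_bounded {X₁ X₂ : Type} [MulAction F X₁] [MulAction F X₂]
    [∀ b, Finite (K b)] (hK : ⨆ b, K b = ⊤)
    (hfree₁ : FreeAct K X₁) (hfree₂ : FreeAct K X₂) {C₁ : Finset X₁} {C₂ : Finset X₂}
    (hC₁ : IsCore K C₁) (hC₂ : IsCore K C₂) (htrans₁ : ∀ x y : X₁, ∃ w : F, w • x = y)
    (htrans₂ : ∀ x y : X₂, ∃ w : F, w • x = y) (E : Finset (X₁ × X₂)) :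
    defect K E ≤ (C₁ ×ˢ C₂).card := by
  obtain ⟨E', hE', h⟩ := exists_defect_le_product_core hK hfree₁ hfree₂ hC₁ hC₂ htrans₁ htrans₂ E
  have := defect_le_card (K := K) E'
  have := Finset.card_le_card hE'
  omega

theorem stabilizer_prod_mk (H₁ H₂ : Subgroup F) (s : F) :
    MulAction.stabilizer F ((QuotientGroup.mk 1, QuotientGroup.mk s) : (F ⧸ H₁) × (F ⧸ H₂)) =
      H₁ ⊓ conjS s H₂ := by
  ext w
  rw [MulAction.mem_stabilizer_iff, Prod.smul_mk, Prod.mk.injEq, MulAction.Quotient.smul_mk,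
    MulAction.Quotient.smul_mk, Subgroup.mem_inf]
  refine and_congr ?_ ?_
  · rw [eq_comm, QuotientGroup.eq]
    simp
  · rw [eq_comm, QuotientGroup.eq, conjS, Subgroup.mem_map]
    constructor
    · intro h
      refine ⟨_, h, ?_⟩
      simp [mul_assoc]
    · rintro ⟨k, hk, rfl⟩
      simpa [mul_assoc] using hk

/-- The double coset determined by a pair of cosets. -/
def dcIndex (H₁ H₂ : Subgroup F) (y : (F ⧸ H₁) × (F ⧸ H₂)) : Quotient (dcSetoid H₁ H₂) :=
  Quotient.mk _ (y.1.out⁻¹ * y.2.out)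

/-- A representative of the `F`-orbit of pairs of cosets determined by a double coset. -/
def dcPoint (H₁ H₂ : Subgroup F) (q : Quotient (dcSetoid H₁ H₂)) : (F ⧸ H₁) × (F ⧸ H₂) :=
  (QuotientGroup.mk 1, QuotientGroup.mk q.out)

theorem dcIndex_mk (H₁ H₂ : Subgroup F) (a b : F) :
    dcIndex H₁ H₂ (QuotientGroup.mk a, QuotientGroup.mk b) = Quotient.mk _ (a⁻¹ * b) := by
  refine (Quotient.sound ?_).symm
  obtain ⟨h, hh⟩ := QuotientGroup.mk_out_eq_mul H₁ a
  obtain ⟨k, hk⟩ := QuotientGroup.mk_out_eq_mul H₂ b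
  refine ⟨(h : F)⁻¹, H₁.inv_mem h.2, k, k.2, ?_⟩
  simp only
  rw [hh, hk]
  group

theorem dcIndex_smul (H₁ H₂ : Subgroup F) (w : F) (y : (F ⧸ H₁) × (F ⧸ H₂)) :
    dcIndex H₁ H₂ (w • y) = dcIndex H₁ H₂ y := by
  obtain ⟨⟨a⟩, ⟨b⟩⟩ := y
  refine (dcIndex_mk H₁ H₂ (w * a) (w * b)).trans (Eq.trans ?_ (dcIndex_mk H₁ H₂ a b).symm)
  congr 1
  group

theorem dcIndex_dcPoint (H₁ H₂ : Subgroup F) (q : Quotient (dcSetoid H₁ H₂)) :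
    dcIndex H₁ H₂ (dcPoint H₁ H₂ q) = q := by
  rw [dcPoint, dcIndex_mk]
  simp

theorem exists_smul_dcPoint (H₁ H₂ : Subgroup F) (y : (F ⧸ H₁) × (F ⧸ H₂)) :
    ∃ w : F, w • dcPoint H₁ H₂ (dcIndex H₁ H₂ y) = y := by
  obtain ⟨⟨a⟩, ⟨b⟩⟩ := y
  change ∃ w : F, w • dcPoint H₁ H₂ (dcIndex H₁ H₂ (QuotientGroup.mk a, QuotientGroup.mk b)) =
    (QuotientGroup.mk a, QuotientGroup.mk b)
  rw [dcIndex_mk]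
  obtain ⟨h, hh, k, hk, he⟩ := Quotient.exact (Quotient.out_eq
    (Quotient.mk (dcSetoid H₁ H₂) (a⁻¹ * b)))
  refine ⟨a * h, ?_⟩
  rw [dcPoint, Prod.smul_mk, Prod.mk.injEq, MulAction.Quotient.smul_mk, MulAction.Quotient.smul_mk]
  refine ⟨(QuotientGroup.eq.2 ?_).symm, (QuotientGroup.eq.2 ?_).symm⟩
  · simpa using hh
  · have : b⁻¹ * (a * h * (Quotient.mk (dcSetoid H₁ H₂) (a⁻¹ * b)).out) = k⁻¹ := by
      rw [eq_inv_iff_mul_eq_one]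
      calc _ = b⁻¹ * a * (h * (Quotient.mk (dcSetoid H₁ H₂) (a⁻¹ * b)).out * k) := by group
        _ = 1 := by rw [he]; group
    simpa only [smul_eq_mul, this] using H₂.inv_mem hk

theorem defect_biUnion {H₁ H₂ : Subgroup F} (Q : Finset (Quotient (dcSetoid H₁ H₂)))
    (E : Quotient (dcSetoid H₁ H₂) → Finset ((F ⧸ H₁) × (F ⧸ H₂)))
    (hE : ∀ q ∈ Q, ∀ y ∈ E q, dcIndex H₁ H₂ y = q) :
    defect K (Q.biUnion E) = ∑ q ∈ Q, defect K (E q) := by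
  induction Q using Finset.induction_on with
  | empty => simp
  | insert q Q hq ih =>
    rw [Finset.biUnion_insert, Finset.sum_insert hq, defect_union, ih]
    · exact fun q' hq' => hE q' (Finset.mem_insert_of_mem hq')
    · intro b x hx y hy hxy
      obtain ⟨q', hq', hy⟩ := Finset.mem_biUnion.1 hy
      obtain ⟨g, -, rfl⟩ := orb_eq.1 hxy
      have h1 := hE q (Finset.mem_insert_self _ _) _ hx
      rw [dcIndex_smul, hE q' (Finset.mem_insert_of_mem hq') y hy] at h1
      exact hq (h1 ▸ hq')

theorem exists_rrk_inter_le_defect (hK : IsFreeProd K) {H₁ H₂ : Subgroup F}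
    (hfree : FreeAct K ((F ⧸ H₁) × (F ⧸ H₂))) {n : ℤ}
    (hn : ∀ E : Finset ((F ⧸ H₁) × (F ⧸ H₂)), defect K E ≤ n)
    (q : Quotient (dcSetoid H₁ H₂)) :
    ∃ E : Finset ((F ⧸ H₁) × (F ⧸ H₂)), (∀ y ∈ E, dcIndex H₁ H₂ y = q) ∧
      (rrk (H₁ ⊓ conjS q.out H₂) : ℤ) ≤ defect K E := by
  obtain ⟨E, hE, h⟩ := exists_rrk_stabilizer_le_defect hK hfree hn (dcPoint H₁ H₂ q)
  refine ⟨E, fun y hy => ?_, ?_⟩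
  · obtain ⟨w, rfl⟩ := hE y hy
    rw [dcIndex_smul, dcIndex_dcPoint]
  · rwa [dcPoint, stabilizer_prod_mk] at h

theorem finite_support_rrk_inter (hK : IsFreeProd K) {H₁ H₂ : Subgroup F}
    (hfree : FreeAct K ((F ⧸ H₁) × (F ⧸ H₂))) {n : ℤ}
    (hn : ∀ E : Finset ((F ⧸ H₁) × (F ⧸ H₂)), defect K E ≤ n) :
    (Function.support fun q : Quotient (dcSetoid H₁ H₂) =>
      rrk (H₁ ⊓ conjS q.out H₂)).Finite := by
  by_contra hinf
  obtain ⟨Q, hQ, hcard⟩ := Set.Infinite.exists_subset_card_eq hinf (n.toNat + 1)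
  choose E hE hEd using exists_rrk_inter_le_defect hK hfree hn
  have h1 := hn (Q.biUnion E)
  rw [defect_biUnion Q E fun q _ => hE q] at h1
  have h2 : (Q.card : ℤ) ≤ ∑ q ∈ Q, defect K (E q) := by
    rw [Finset.card_eq_sum_ones, Nat.cast_sum]
    refine Finset.sum_le_sum fun q hq => le_trans ?_ (hEd q)
    have := hQ hq
    rw [Function.mem_support] at this
    exact_mod_cast Nat.one_le_iff_ne_zero.2 this
  omega

theorem exists_rrkInter_le_defect (hK : IsFreeProd K) {H₁ H₂ : Subgroup F}
    (hfree : FreeAct K ((F ⧸ H₁) × (F ⧸ H₂))) {n : ℤ}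
    (hn : ∀ E : Finset ((F ⧸ H₁) × (F ⧸ H₂)), defect K E ≤ n) :
    ∃ E : Finset ((F ⧸ H₁) × (F ⧸ H₂)), (rrkInter H₁ H₂ : ℤ) ≤ defect K E := by
  choose E hE hEd using exists_rrk_inter_le_defect hK hfree hn
  refine ⟨(finite_support_rrk_inter hK hfree hn).toFinset.biUnion E, ?_⟩
  rw [defect_biUnion _ E fun q _ => hE q, rrkInter,
    finsum_eq_sum _ (finite_support_rrk_inter hK hfree hn), Nat.cast_sum]
  exact Finset.sum_le_sum fun q _ => hEd q

theorem defect_le_rrkInter (hK : IsFreeProd K) {H₁ H₂ : Subgroup F}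
    (hfree : FreeAct K ((F ⧸ H₁) × (F ⧸ H₂))) {n : ℤ}
    (hn : ∀ E : Finset ((F ⧸ H₁) × (F ⧸ H₂)), defect K E ≤ n)
    (E : Finset ((F ⧸ H₁) × (F ⧸ H₂))) :
    defect K E ≤ rrkInter H₁ H₂ := by
  have hsub : (Function.support fun q : Quotient (dcSetoid H₁ H₂) =>
      rrk (H₁ ⊓ conjS q.out H₂)) ⊆
      (E.image (dcIndex H₁ H₂) ∪ (finite_support_rrk_inter hK hfree hn).toFinset : Finset _) := by
    intro q hq
    simp only [Finset.coe_union, Set.Finite.coe_toFinset]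
    exact Or.inr hq
  have hE : E = (E.image (dcIndex H₁ H₂)).biUnion fun q =>
      E.filter fun y => dcIndex H₁ H₂ y = q := by
    ext y
    simp only [Finset.mem_biUnion, Finset.mem_image, Finset.mem_filter]
    exact ⟨fun hy => ⟨_, ⟨y, hy, rfl⟩, hy, rfl⟩, fun ⟨_, _, hy, _⟩ => hy⟩
  rw [rrkInter, finsum_eq_sum_of_support_subset _ hsub, Nat.cast_sum]
  conv_lhs => rw [hE]
  rw [defect_biUnion _ _ fun q _ y hy => (Finset.mem_filter.1 hy).2]
  refine (Finset.sum_le_sum fun q _ => ?_).trans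
    (Finset.sum_le_sum_of_subset_of_nonneg Finset.subset_union_left fun q _ _ => by positivity)
  have h := defect_le_rrk_stabilizer hK (x₀ := dcPoint H₁ H₂ q)
    (stabilizer_fg_of_bounded hK hfree hn _) (E := E.filter fun y => dcIndex H₁ H₂ y = q)
    fun y hy => by
      obtain ⟨-, rfl⟩ := Finset.mem_filter.1 hy
      exact exists_smul_dcPoint H₁ H₂ y
  rwa [dcPoint, stabilizer_prod_mk] at h

/-- The linear form on `ι → ℕ` with integer coefficients `f`. -/
def weight {ι : Type} [Fintype ι] (f : ι → ℤ) : (ι → ℕ) →+ ℤ where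
  toFun v := ∑ i, (v i : ℤ) * f i
  map_zero' := by simp
  map_add' v w := by
    rw [← Finset.sum_add_distrib]
    exact Finset.sum_congr rfl fun i _ => by simp [add_mul]

theorem weight_apply {ι : Type} [Fintype ι] (f : ι → ℤ) (v : ι → ℕ) :
    weight f v = ∑ i, (v i : ℤ) * f i := rfl

/-- On a finitely generated monoid, the ratio of two linear forms attains its maximum. -/
theorem exists_max_ratio {ι : Type} {M : AddSubmonoid (ι → ℕ)} (hM : M.FG)
    (b c : (ι → ℕ) →+ ℤ) (hc : ∀ v ∈ M, 0 ≤ c v) (hb : ∀ v ∈ M, c v = 0 → b v ≤ 0)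
    (hex : ∃ v ∈ M, 0 < c v) :
    ∃ u ∈ M, 0 < c u ∧ ∀ v ∈ M, b v * c u ≤ b u * c v := by
  obtain ⟨S, rfl⟩ := hM
  have hne : (S.filter fun s => 0 < c s).Nonempty := by
    by_contra hemp
    rw [Finset.not_nonempty_iff_eq_empty, Finset.filter_eq_empty_iff] at hemp
    obtain ⟨v, hv, hcv⟩ := hex
    have : c v = 0 := by
      clear hcv
      induction hv using AddSubmonoid.closure_induction with
      | mem s hs => exact le_antisymm (not_lt.1 (hemp hs)) (hc s (AddSubmonoid.subset_closure hs))
      | zero => exact map_zero c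
      | add x y _ _ hx hy => rw [map_add, hx, hy, add_zero]
    omega
  obtain ⟨u, hu, hmax⟩ := Finset.exists_max_image _ (fun s => (b s : ℚ) / (c s : ℚ)) hne
  rw [Finset.mem_filter] at hu
  refine ⟨u, AddSubmonoid.subset_closure hu.1, hu.2, fun v hv => ?_⟩
  induction hv using AddSubmonoid.closure_induction with
  | mem s hs =>
    have hs' := AddSubmonoid.subset_closure hs
    rcases (hc s hs').eq_or_lt with h0 | hpos
    · rw [← h0, mul_zero]
      exact mul_nonpos_of_nonpos_of_nonneg (hb s hs' h0.symm) hu.2.le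
    · have h := hmax s (Finset.mem_filter.2 ⟨hs, hpos⟩)
      rw [div_le_div_iff₀ (by exact_mod_cast hpos) (by exact_mod_cast hu.2)] at h
      exact_mod_cast h
  | zero => simp
  | add x y _ _ hx hy =>
    rw [map_add, map_add, add_mul, mul_add]
    exact add_le_add hx hy

section LocalTypes

variable {X₁ : Type}

/-- The labels: subsets of `C`. -/
abbrev Lab (C : Finset X₁) : Type := {A : Finset X₁ // A ∈ C.powerset}

/-- The set underlying an optional label. -/
def labSet {C : Finset X₁} : Option (Lab C) → Finset X₁
  | none => ∅
  | some A => A.1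

variable [∀ b, Fintype (K b)] {C : Finset X₁}

/-- The number of group elements with a given label. -/
def degLab {b : Bool} (τ : K b → Option (Lab C)) (A : Lab C) : ℕ :=
  (Finset.univ.filter fun g => τ g = some A).card

variable (K C) in
/-- The local types of vertices of degree at least two. -/
abbrev VType (b : Bool) : Type :=
  {τ : K b → Option (Lab C) // ∃ g h, g ≠ h ∧ τ g ≠ none ∧ τ h ≠ none}

theorem two_le_sum_degLab {b : Bool} (t : VType K C b) : 2 ≤ ∑ A, degLab t.1 A := by
  obtain ⟨τ, g, h, hgh, hg, hh⟩ := t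
  have h1 : (Finset.univ.filter fun g => τ g ≠ none).card = ∑ A, degLab τ A := by
    rw [Finset.card_eq_sum_card_fiberwise (f := τ) (t := Finset.univ) (fun _ _ => by simp),
      Fintype.sum_option]
    simp only [degLab, Finset.filter_filter]
    have h0 : (Finset.univ.filter fun a => τ a ≠ none ∧ τ a = none).card = 0 := by
      rw [Finset.card_eq_zero, Finset.filter_eq_empty_iff]
      exact fun _ _ h => h.1 h.2
    rw [h0, zero_add]
    refine Finset.sum_congr rfl fun A _ => ?_
    congr 1
    ext a
    simp only [Finset.mem_filter, Finset.mem_univ, true_and]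
    exact ⟨fun h => h.2, fun h => ⟨by simp [h], h⟩⟩
  rw [← h1, ← Finset.card_pair hgh]
  refine Finset.card_le_card fun x hx => ?_
  rw [Finset.mem_insert, Finset.mem_singleton] at hx
  rcases hx with rfl | rfl <;> simpa

/-- The coefficients of the defect of the base. -/
def baseCoeff (i : Σ b, VType K C b) : ℤ :=
  (if i.1 then ((∑ A, degLab i.2.1 A : ℕ) : ℤ) else 0) - 1

/-- The number of edges with label `A` seen from the vertices on side `b`. -/
def edgeCount (b : Bool) (v : (Σ b, VType K C b) → ℕ) (A : Lab C) : ℕ :=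
  ∑ t : VType K C b, v ⟨b, t⟩ * degLab t.1 A

variable (K C) in
/-- The vectors counting local types for which the numbers of edges with a given label agree on
both sides. -/
def typeMonoid : AddSubmonoid ((Σ b, VType K C b) → ℕ) :=
  AddMonoidHom.eqLocusM
    (⟨⟨fun v A => edgeCount true v A, by ext; simp [edgeCount]⟩, fun v w => by
      ext; simp [edgeCount, add_mul, Finset.sum_add_distrib]⟩ : _ →+ (Lab C → ℕ))
    (⟨⟨fun v A => edgeCount false v A, by ext; simp [edgeCount]⟩, fun v w => by
      ext; simp [edgeCount, add_mul, Finset.sum_add_distrib]⟩ : _ →+ (Lab C → ℕ))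

theorem mem_typeMonoid {v : (Σ b, VType K C b) → ℕ} :
    v ∈ typeMonoid K C ↔ ∀ A, edgeCount true v A = edgeCount false v A :=
  funext_iff

theorem weight_baseCoeff (v : (Σ b, VType K C b) → ℕ) :
    weight baseCoeff v = ∑ A, (edgeCount true v A : ℤ) -
      ∑ b, ∑ t : VType K C b, (v ⟨b, t⟩ : ℤ) := by
  rw [weight_apply, Fintype.sum_sigma, Fintype.sum_bool, Fintype.sum_bool]
  simp only [baseCoeff, edgeCount, mul_sub, mul_one, Finset.sum_sub_distrib, if_true, mul_zero,
    Bool.false_eq_true, if_false, Finset.sum_const_zero]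
  push_cast
  rw [Finset.sum_comm]
  simp only [Finset.mul_sum]
  ring

theorem two_mul_weight_baseCoeff {v : (Σ b, VType K C b) → ℕ} (hv : v ∈ typeMonoid K C) :
    2 * weight baseCoeff v =
      ∑ b, ∑ t : VType K C b, (v ⟨b, t⟩ : ℤ) * ((∑ A, degLab t.1 A : ℕ) - 2) := by
  have h : ∀ b, ∑ t : VType K C b, (v ⟨b, t⟩ : ℤ) * ((∑ A, degLab t.1 A : ℕ) - 2) =
      ∑ A, (edgeCount b v A : ℤ) - 2 * ∑ t : VType K C b, (v ⟨b, t⟩ : ℤ) := by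
    intro b
    simp only [edgeCount, mul_sub, Finset.sum_sub_distrib]
    push_cast
    rw [Finset.sum_comm]
    simp only [Finset.mul_sum]
    congr 1
    exact Finset.sum_congr rfl fun t _ => by ring
  have h2 : ∑ A, (edgeCount true v A : ℤ) = ∑ A, (edgeCount false v A : ℤ) :=
    Finset.sum_congr rfl fun A _ => by rw [mem_typeMonoid.1 hv A]
  rw [weight_baseCoeff, Fintype.sum_bool, Fintype.sum_bool, h, h]
  linarith

theorem weight_baseCoeff_nonneg {v : (Σ b, VType K C b) → ℕ} (hv : v ∈ typeMonoid K C) :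
    0 ≤ weight baseCoeff v := by
  have h := two_mul_weight_baseCoeff hv
  have h2 : 0 ≤ ∑ b, ∑ t : VType K C b, (v ⟨b, t⟩ : ℤ) * ((∑ A, degLab t.1 A : ℕ) - 2) := by
    refine Finset.sum_nonneg fun b _ => Finset.sum_nonneg fun t _ => ?_
    have := two_le_sum_degLab t
    exact mul_nonneg (by positivity) (by omega)
  omega

theorem typeMonoid_fg : (typeMonoid K C).FG := AddSubmonoid.fg_eqLocusM _ _

variable [MulAction F X₁]

/-- Representatives of the orbits in the fibre product above a vertex with local type `τ`. -/
def orbReps {b : Bool} (τ : K b → Option (Lab C)) : Finset X₁ :=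
  Finset.univ.biUnion fun g : K b => (labSet (τ g)).image fun x => (g : F)⁻¹ • x

theorem card_mul_degLab_le {b : Bool} (τ : K b → Option (Lab C)) (A : Lab C) :
    A.1.card * degLab τ A ≤ (orbReps τ).card * degLab τ A := by
  rcases Nat.eq_zero_or_pos (degLab τ A) with h | h
  · simp [h]
  · refine Nat.mul_le_mul_right _ ?_
    obtain ⟨g, hg⟩ := Finset.card_pos.1 h
    rw [Finset.mem_filter] at hg
    rw [← Finset.card_image_of_injective A.1 (MulAction.injective (g : F)⁻¹)]
    refine Finset.card_le_card fun x hx => ?_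
    exact Finset.mem_biUnion.2 ⟨g, Finset.mem_univ _, by rw [hg.2]; exact hx⟩

/-- The coefficients of the defect of the fibre product. -/
def prodCoeff (i : Σ b, VType K C b) : ℤ :=
  (if i.1 then ((∑ A : Lab C, A.1.card * degLab i.2.1 A : ℕ) : ℤ) else 0) - (orbReps i.2.1).card

theorem weight_prodCoeff (v : (Σ b, VType K C b) → ℕ) :
    weight prodCoeff v = ∑ A : Lab C, (A.1.card : ℤ) * edgeCount true v A -
      ∑ b, ∑ t : VType K C b, (v ⟨b, t⟩ : ℤ) * (orbReps t.1).card := by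
  rw [weight_apply, Fintype.sum_sigma, Fintype.sum_bool, Fintype.sum_bool]
  simp only [prodCoeff, edgeCount, mul_sub, Finset.sum_sub_distrib, if_true, mul_zero,
    Bool.false_eq_true, if_false, Finset.sum_const_zero]
  push_cast
  simp only [Finset.mul_sum]
  rw [Finset.sum_comm]
  have : ∀ (t : VType K C true) (A : Lab C), (v ⟨true, t⟩ : ℤ) * ((A.1.card : ℤ) * degLab t.1 A) =
      (A.1.card : ℤ) * ((v ⟨true, t⟩ : ℤ) * degLab t.1 A) := fun t A => by ring
  simp only [this]
  ring

theorem two_mul_weight_prodCoeff {v : (Σ b, VType K C b) → ℕ} (hv : v ∈ typeMonoid K C) :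
    2 * weight prodCoeff v = ∑ b, ∑ t : VType K C b, (v ⟨b, t⟩ : ℤ) *
      ((∑ A : Lab C, A.1.card * degLab t.1 A : ℕ) - 2 * (orbReps t.1).card) := by
  have h : ∀ b, ∑ t : VType K C b, (v ⟨b, t⟩ : ℤ) *
      ((∑ A : Lab C, A.1.card * degLab t.1 A : ℕ) - 2 * (orbReps t.1).card) =
      ∑ A : Lab C, (A.1.card : ℤ) * edgeCount b v A -
        2 * ∑ t : VType K C b, (v ⟨b, t⟩ : ℤ) * (orbReps t.1).card := by
    intro b
    simp only [edgeCount, mul_sub, Finset.sum_sub_distrib]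
    push_cast
    simp only [Finset.mul_sum]
    rw [Finset.sum_comm]
    congr 1
    · exact Finset.sum_congr rfl fun A _ => Finset.sum_congr rfl fun t _ => by ring
    · exact Finset.sum_congr rfl fun t _ => by ring
  have h2 : ∑ A : Lab C, (A.1.card : ℤ) * edgeCount true v A =
      ∑ A : Lab C, (A.1.card : ℤ) * edgeCount false v A :=
    Finset.sum_congr rfl fun A _ => by rw [mem_typeMonoid.1 hv A]
  rw [weight_prodCoeff, Fintype.sum_bool, Fintype.sum_bool, h, h]
  linarith

theorem weight_prodCoeff_nonpos {v : (Σ b, VType K C b) → ℕ} (hv : v ∈ typeMonoid K C)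
    (h0 : weight baseCoeff v = 0) : weight prodCoeff v ≤ 0 := by
  have h := two_mul_weight_baseCoeff hv
  rw [h0, mul_zero] at h
  have hnn : ∀ b, ∀ t : VType K C b,
      0 ≤ (v ⟨b, t⟩ : ℤ) * ((∑ A, degLab t.1 A : ℕ) - 2) := fun b t => by
    have := two_le_sum_degLab t
    exact mul_nonneg (by positivity) (by omega)
  have hz : ∀ b, ∀ t : VType K C b,
      (v ⟨b, t⟩ : ℤ) * ((∑ A, degLab t.1 A : ℕ) - 2) = 0 := fun b t => by
    have h1 := (Finset.sum_eq_zero_iff_of_nonneg fun b _ =>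
      Finset.sum_nonneg fun t _ => hnn b t).1 h.symm b (Finset.mem_univ _)
    exact (Finset.sum_eq_zero_iff_of_nonneg fun t _ => hnn b t).1 h1 t (Finset.mem_univ _)
  have h2 := two_mul_weight_prodCoeff hv
  have h3 : ∑ b, ∑ t : VType K C b, (v ⟨b, t⟩ : ℤ) *
      ((∑ A : Lab C, A.1.card * degLab t.1 A : ℕ) - 2 * (orbReps t.1).card) ≤ 0 := by
    refine Finset.sum_nonpos fun b _ => Finset.sum_nonpos fun t _ => ?_
    have h4 : ∑ A : Lab C, A.1.card * degLab t.1 A ≤ (orbReps t.1).card * ∑ A, degLab t.1 A := by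
      rw [Finset.mul_sum]
      exact Finset.sum_le_sum fun A _ => card_mul_degLab_le t.1 A
    have h5 : ((∑ A : Lab C, A.1.card * degLab t.1 A : ℕ) : ℤ) ≤
        (orbReps t.1).card * (∑ A, degLab t.1 A : ℕ) := by exact_mod_cast h4
    calc _ ≤ (v ⟨b, t⟩ : ℤ) * ((orbReps t.1).card * (∑ A, degLab t.1 A : ℕ)
          - 2 * (orbReps t.1).card) :=
          mul_le_mul_of_nonneg_left (by linarith) (by positivity)
      _ = (orbReps t.1).card * ((v ⟨b, t⟩ : ℤ) * ((∑ A, degLab t.1 A : ℕ) - 2)) := by ring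
      _ ≤ 0 := by rw [hz, mul_zero]
  omega

end LocalTypes

section FibreProduct

variable {X₁ X₂ : Type} {C : Finset X₁}

/-- The points of the fibre product lying above the labelled points in `E`. -/
def prodSet (ℓ : X₂ → Option (Lab C)) (E : Finset X₂) : Finset (X₁ × X₂) :=
  E.biUnion fun x => (labSet (ℓ x)).map ⟨fun a => (a, x), Prod.mk_left_injective x⟩

theorem mem_prodSet {ℓ : X₂ → Option (Lab C)} {E : Finset X₂} {y : X₁ × X₂} :
    y ∈ prodSet ℓ E ↔ y.2 ∈ E ∧ y.1 ∈ labSet (ℓ y.2) := by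
  obtain ⟨a, x⟩ := y
  simp only [prodSet, Finset.mem_biUnion, Finset.mem_map, Function.Embedding.coeFn_mk,
    Prod.mk.injEq]
  constructor
  · rintro ⟨x, hx, a, ha, rfl, rfl⟩
    exact ⟨hx, ha⟩
  · rintro ⟨hx, ha⟩
    exact ⟨x, hx, a, ha, rfl, rfl⟩

theorem card_prodSet {ℓ : X₂ → Option (Lab C)} {E : Finset X₂} :
    (prodSet ℓ E).card = ∑ A : Lab C, A.1.card * (E.filter fun x => ℓ x = some A).card := by
  have h1 : (prodSet ℓ E).card = ∑ x ∈ E, (labSet (ℓ x)).card := by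
    rw [prodSet, Finset.card_biUnion]
    · exact Finset.sum_congr rfl fun x _ => Finset.card_map _
    · intro x _ y _ hxy
      refine Finset.disjoint_left.2 ?_
      rintro ⟨a, z⟩ h h'
      simp only [Finset.mem_map, Function.Embedding.coeFn_mk, Prod.mk.injEq] at h h'
      obtain ⟨_, _, _, rfl⟩ := h
      obtain ⟨_, _, _, h⟩ := h'
      exact hxy h.symm
  rw [h1, ← Finset.sum_fiberwise E ℓ, Fintype.sum_option]
  rw [Finset.sum_eq_zero, zero_add]
  · refine Finset.sum_congr rfl fun A _ => ?_
    rw [Finset.sum_congr rfl (g := fun _ => A.1.card), Finset.sum_const, smul_eq_mul, mul_comm]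
    intro x hx
    rw [(Finset.mem_filter.1 hx).2]
    rfl
  · intro x hx
    rw [(Finset.mem_filter.1 hx).2]
    rfl

variable [MulAction F X₂]

/-- A parametrization by `I` of the `K b`-orbits meeting the labelled points. -/
structure Transversal (b : Bool) {I : Type} (ℓ : X₂ → Option (Lab C)) (base : I → X₂)
    (t : I → VType K C b) : Prop where
  type : ∀ i (g : K b), (t i).1 g = ℓ ((g : F) • base i)
  inj : ∀ i j, orb K b (base i) = orb K b (base j) → i = j
  cover : ∀ x, ℓ x ≠ none → ∃ i, orb K b x = orb K b (base i)

section

variable {b : Bool} {I : Type} [Fintype I] {ℓ : X₂ → Option (Lab C)} {base : I → X₂}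
  {t : I → VType K C b} {E : Finset X₂}

theorem Transversal.orbCount_eq (hT : Transversal b ℓ base t)
    (hE : ∀ x, x ∈ E ↔ ℓ x ≠ none) : orbCount K b E = Fintype.card I := by
  have : E.image (orb K b) = Finset.univ.image fun i => orb K b (base i) := by
    ext q
    simp only [Finset.mem_image, Finset.mem_univ, true_and]
    constructor
    · rintro ⟨x, hx, rfl⟩
      obtain ⟨i, hi⟩ := hT.cover x ((hE x).1 hx)
      exact ⟨i, hi.symm⟩
    · rintro ⟨i, rfl⟩
      obtain ⟨g, h, -, hg, -⟩ := (t i).2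
      exact ⟨(g : F) • base i, (hE _).2 (by rw [← hT.type]; exact hg), orb_smul g.2 _⟩
  rw [orbCount, this, Finset.card_image_of_injective _ fun i j h => hT.inj i j h,
    Finset.card_univ]

variable [∀ b, Fintype (K b)]

theorem Transversal.card_filter (hT : Transversal b ℓ base t) (hfree : FreeAct K X₂)
    (hE : ∀ x, x ∈ E ↔ ℓ x ≠ none) (A : Lab C) :
    (E.filter fun x => ℓ x = some A).card = ∑ i, degLab (t i).1 A := by
  unfold degLab
  rw [← Finset.card_sigma]
  refine (Finset.card_bij (fun p _ => (p.2 : F) • base p.1) ?_ ?_ ?_).symm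
  · rintro ⟨i, g⟩ h
    simp only [Finset.mem_sigma, Finset.mem_univ, Finset.mem_filter, true_and] at h
    rw [hT.type] at h
    simp [hE, h]
  · rintro ⟨i, g⟩ _ ⟨j, g'⟩ _ h
    simp only at h
    obtain rfl := hT.inj i j (by rw [← orb_smul g.2, h, orb_smul g'.2])
    have h1 := hfree b ((g' : F)⁻¹ * g) ((K b).mul_mem ((K b).inv_mem g'.2) g.2) (base i)
      (by rw [mul_smul, h, inv_smul_smul])
    have h2 : g = g' := Subtype.ext (inv_mul_eq_one.1 h1).symm
    rw [h2]
  · intro x hx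
    rw [Finset.mem_filter] at hx
    obtain ⟨i, hi⟩ := hT.cover x ((hE x).1 hx.1)
    obtain ⟨g, hg, rfl⟩ := orb_eq.1 hi
    refine ⟨⟨i, ⟨g, hg⟩⟩, ?_, rfl⟩
    simpa [hT.type] using hx.2

theorem Transversal.orbCount_prodSet [MulAction F X₁] (hT : Transversal b ℓ base t) (hfree : FreeAct K X₂)
    (hE : ∀ x, x ∈ E ↔ ℓ x ≠ none) :
    orbCount K b (prodSet ℓ E) = ∑ i, (orbReps (t i).1).card := by
  rw [← Finset.card_sigma]
  refine (Finset.card_bij (fun p _ => orb K b (p.2, base p.1)) ?_ ?_ ?_).symm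
  · rintro ⟨i, a⟩ h
    simp only [Finset.mem_sigma, Finset.mem_univ, true_and, orbReps, Finset.mem_biUnion,
      Finset.mem_image] at h
    obtain ⟨g, x, hx, rfl⟩ := h
    refine Finset.mem_image.2 ⟨(x, (g : F) • base i), mem_prodSet.2 ⟨(hE _).2 ?_, ?_⟩, ?_⟩
    · rw [← hT.type]
      intro h0
      rw [h0] at hx
      simp [labSet] at hx
    · rwa [← hT.type]
    · exact orb_eq.2 ⟨g, g.2, by simp⟩
  · rintro ⟨i, a⟩ _ ⟨j, a'⟩ _ h
    obtain ⟨g, hg, hga⟩ := orb_eq.1 h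
    simp only [Prod.smul_mk, Prod.mk.injEq] at hga
    obtain ⟨hga, hgb⟩ := hga
    obtain rfl := hT.inj i j (orb_eq.2 ⟨g, hg, hgb⟩)
    rw [hfree b g hg _ hgb, one_smul] at hga
    rw [hga]
  · intro q hq
    obtain ⟨⟨x, y⟩, hy, rfl⟩ := Finset.mem_image.1 hq
    rw [mem_prodSet] at hy
    obtain ⟨i, hi⟩ := hT.cover y ((hE y).1 hy.1)
    obtain ⟨g, hg, rfl⟩ := orb_eq.1 hi
    refine ⟨⟨i, g⁻¹ • x⟩, ?_, ?_⟩
    · simp only [Finset.mem_sigma, Finset.mem_univ, true_and, orbReps, Finset.mem_biUnion,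
        Finset.mem_image]
      exact ⟨⟨g, hg⟩, x, by rw [hT.type]; exact hy.2, rfl⟩
    · exact orb_eq.2 ⟨g⁻¹, (K b).inv_mem hg, by simp⟩

end

variable [∀ b, Fintype (K b)]

theorem sum_card_fiber_mul {I T : Type} [Fintype I] [Fintype T] (t : I → T) (f : T → ℕ) :
    ∑ s, Nat.card {i // t i = s} * f s = ∑ i, f (t i) := by
  simp only [Nat.card_eq_fintype_card, Fintype.card_subtype]
  rw [← Finset.sum_fiberwise Finset.univ t]
  refine Finset.sum_congr rfl fun s _ => ?_
  rw [Finset.sum_congr rfl (g := fun _ => f s), Finset.sum_const, smul_eq_mul]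
  intro i hi
  rw [(Finset.mem_filter.1 hi).2]

theorem weights_of_transversals [MulAction F X₁] (hfree : FreeAct K X₂)
    {ℓ : X₂ → Option (Lab C)} {E : Finset X₂}
    (hE : ∀ x, x ∈ E ↔ ℓ x ≠ none) {I : Bool → Type} [∀ b, Fintype (I b)]
    {base : ∀ b, I b → X₂} {t : ∀ b, I b → VType K C b}
    (hT : ∀ b, Transversal b ℓ (base b) (t b)) {v : (Σ b, VType K C b) → ℕ}
    (hv : ∀ b s, v ⟨b, s⟩ = Nat.card {i // t b i = s}) :
    v ∈ typeMonoid K C ∧ defect K E = weight baseCoeff v ∧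
      defect K (prodSet ℓ E) = weight prodCoeff v := by
  have h1 : ∀ b A, edgeCount b v A = (E.filter fun x => ℓ x = some A).card := fun b A => by
    rw [(hT b).card_filter hfree hE, edgeCount,
      ← sum_card_fiber_mul (t b) fun s => degLab s.1 A]
    simp only [hv]
  have h2 : ∀ b, ∑ s : VType K C b, (v ⟨b, s⟩ : ℤ) = orbCount K b E := fun b => by
    rw [(hT b).orbCount_eq hE, Fintype.card_eq_sum_ones, ← sum_card_fiber_mul (t b) fun _ => 1]
    simp [hv]
  have h3 : ∀ b, ∑ s : VType K C b, (v ⟨b, s⟩ : ℤ) * (orbReps s.1).card =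
      orbCount K b (prodSet ℓ E) := fun b => by
    rw [(hT b).orbCount_prodSet hfree hE,
      ← sum_card_fiber_mul (t b) fun s => (orbReps s.1).card]
    simp [hv]
  have h4 : (E.card : ℤ) = ∑ A, (edgeCount true v A : ℤ) := by
    rw [← Nat.cast_sum]
    congr 1
    rw [← Finset.card_eq_sum_card_fiberwise (f := ℓ) (t := Finset.univ) (fun _ _ => by simp) |>.symm]
    rw [Fintype.sum_option]
    simp only [h1]
    rw [Nat.add_eq_right, Finset.card_eq_zero, Finset.filter_eq_empty_iff]
    exact fun x hx => (hE x).1 hx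
  refine ⟨mem_typeMonoid.2 fun A => by rw [h1, h1], ?_, ?_⟩
  · rw [weight_baseCoeff, Fintype.sum_bool, h2, h2, defect, h4]
    ring
  · rw [weight_prodCoeff, Fintype.sum_bool, h3, h3, defect, card_prodSet]
    simp only [h1]
    push_cast
    ring

/-- Every vertex of the graph of `E` has degree at least two. -/
def MinDegTwo (K : Bool → Subgroup F) (E : Finset X₂) : Prop :=
  ∀ b, ∀ x ∈ E, ∃ y ∈ E, y ≠ x ∧ orb K b y = orb K b x

theorem exists_weights [MulAction F X₁] (hfree : FreeAct K X₂)
    {ℓ : X₂ → Option (Lab C)} {E : Finset X₂}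
    (hE : ∀ x, x ∈ E ↔ ℓ x ≠ none) (htwo : MinDegTwo K E) :
    ∃ v ∈ typeMonoid K C, defect K E = weight baseCoeff v ∧
      defect K (prodSet ℓ E) = weight prodCoeff v := by
  let I : Bool → Type := fun b => {q : Orb K b X₂ // q ∈ E.image (orb K b)}
  let base : ∀ b, I b → X₂ := fun b i => Function.surjInv (orb_surjective b) i.1
  have hbase : ∀ b (i : I b), orb K b (base b i) = i.1 := fun b i =>
    Function.surjInv_eq (orb_surjective b) i.1
  let t : ∀ b, I b → VType K C b := fun b i => ⟨fun g => ℓ ((g : F) • base b i), by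
    obtain ⟨x, hx, hxi⟩ := Finset.mem_image.1 i.2
    obtain ⟨y, hy, hne, hyx⟩ := htwo b x hx
    rw [← hbase] at hxi
    obtain ⟨g, hg, rfl⟩ := orb_eq.1 hxi
    obtain ⟨h, hh, rfl⟩ := orb_eq.1 (hyx.trans hxi)
    refine ⟨⟨g, hg⟩, ⟨h, hh⟩, ?_, (hE _).1 hx, (hE _).1 hy⟩
    rintro h
    rw [Subtype.mk.injEq] at h
    exact hne (by rw [h])⟩
  exact ⟨_, weights_of_transversals hfree hE (I := I) (base := base) (t := t)
    (fun b => ⟨fun _ _ => rfl, fun i j h => Subtype.ext (by rw [← hbase, ← hbase, h]), fun x hx =>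
      ⟨⟨_, Finset.mem_image_of_mem _ ((hE x).2 hx)⟩, by rw [hbase]⟩⟩)
    (v := fun p => Nat.card {i // t p.1 i = p.2}) (fun _ _ => rfl)⟩

end FibreProduct

section Realization

variable {X₁ : Type} {C : Finset X₁}

theorem minDegTwo_of_transversals {X₂ : Type} [MulAction F X₂] (hfree : FreeAct K X₂)
    {ℓ : X₂ → Option (Lab C)} {E : Finset X₂} (hE : ∀ x, x ∈ E ↔ ℓ x ≠ none) {I : Bool → Type}
    {base : ∀ b, I b → X₂} {t : ∀ b, I b → VType K C b}
    (hT : ∀ b, Transversal b ℓ (base b) (t b)) : MinDegTwo K E := by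
  intro b x hx
  obtain ⟨i, hi⟩ := (hT b).cover x ((hE x).1 hx)
  obtain ⟨g, hg, rfl⟩ := orb_eq.1 hi
  obtain ⟨h, hh, hne⟩ : ∃ h, (t b i).1 h ≠ none ∧ h ≠ ⟨g, hg⟩ := by
    obtain ⟨g₁, g₂, h12, h1, h2⟩ := (t b i).2
    by_cases h : g₁ = ⟨g, hg⟩
    · exact ⟨g₂, h2, fun h' => h12 (h.trans h'.symm)⟩
    · exact ⟨g₁, h1, h⟩
  refine ⟨(h : F) • base b i, (hE _).2 (by rw [← (hT b).type]; exact hh), fun heq => hne ?_,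
    by rw [orb_smul h.2, orb_smul hg]⟩
  have h1 := hfree b (g⁻¹ * h) ((K b).mul_mem ((K b).inv_mem hg) h.2) (base b i)
    (by rw [mul_smul, heq, inv_smul_smul])
  exact Subtype.ext (inv_mul_eq_one.1 h1).symm

variable (K C) in
/-- The index set of the vertices on side `b` prescribed by the vector `v`. -/
abbrev VIndex (v : (Σ b, VType K C b) → ℕ) (b : Bool) : Type :=
  Σ s : VType K C b, Fin (v ⟨b, s⟩)

/-- The labels of the points of `(VIndex K C v b ⊕ ℕ) × K b`. -/
def modelLab (v : (Σ b, VType K C b) → ℕ) (b : Bool) :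
    (VIndex K C v b ⊕ ℕ) × K b → Option (Lab C)
  | (Sum.inl i, g) => i.1.1 g
  | (Sum.inr _, _) => none

theorem infinite_modelLab_eq_none (v : (Σ b, VType K C b) → ℕ) (b : Bool) :
    Infinite {y // modelLab v b y = none} :=
  Infinite.of_injective (fun n : ℕ => ⟨(Sum.inr n, 1), rfl⟩) fun _ _ h =>
    Sum.inr_injective (congrArg (fun y => y.1.1) h)

variable [∀ b, Fintype (K b)]

theorem card_modelLab_eq_some (v : (Σ b, VType K C b) → ℕ) (b : Bool) (A : Lab C) :
    Finite {y // modelLab v b y = some A} ∧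
      Nat.card {y // modelLab v b y = some A} = edgeCount b v A := by
  let f : (Σ i : VIndex K C v b, {g // i.1.1 g = some A}) → {y // modelLab v b y = some A} :=
    fun p => ⟨(Sum.inl p.1, p.2.1), p.2.2⟩
  have hf : Function.Bijective f := by
    constructor
    · rintro ⟨i, g, hg⟩ ⟨j, h, hh⟩ hij
      obtain ⟨h1, rfl⟩ := Prod.ext_iff.1 (congrArg Subtype.val hij)
      obtain rfl := Sum.inl_injective h1
      rfl
    · rintro ⟨⟨i | n, g⟩, h⟩
      · exact ⟨⟨i, g, h⟩, rfl⟩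
      · exact absurd h (by simp [modelLab])
  refine ⟨Finite.of_surjective f hf.2, ?_⟩
  rw [← Nat.card_eq_of_bijective f hf, Nat.card_sigma, Fintype.sum_sigma, edgeCount]
  refine Finset.sum_congr rfl fun s _ => ?_
  simp only [Finset.sum_const, Finset.card_univ, Fintype.card_fin, smul_eq_mul]
  rw [Nat.card_eq_fintype_card, Fintype.card_subtype, degLab]

theorem exists_equiv_modelLab {v : (Σ b, VType K C b) → ℕ} (hv : v ∈ typeMonoid K C) :
    ∃ e : (VIndex K C v true ⊕ ℕ) × K true ≃ (VIndex K C v false ⊕ ℕ) × K false,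
      ∀ y, modelLab v false (e y) = modelLab v true y := by
  have h : ∀ o : Option (Lab C),
      Nonempty ({y // modelLab v true y = o} ≃ {y // modelLab v false y = o}) := by
    rintro (_ | A)
    · have := infinite_modelLab_eq_none v true
      have := infinite_modelLab_eq_none v false
      exact nonempty_equiv_of_countable
    · obtain ⟨_, h1⟩ := card_modelLab_eq_some v true A
      obtain ⟨_, h2⟩ := card_modelLab_eq_some v false A
      rw [← Finite.card_eq, h1, h2, mem_typeMonoid.1 hv A]
  let ε := fun o => (h o).some
  refine ⟨(Equiv.sigmaFiberEquiv (modelLab v true)).symm.trans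
    ((Equiv.sigmaCongrRight ε).trans (Equiv.sigmaFiberEquiv (modelLab v false))), fun y => ?_⟩
  exact (ε (modelLab v true y) ⟨y, rfl⟩).2

/-- Transport of left translation on the second coordinate. -/
def translationHom {b : Bool} {Z W : Type} (ε : W ≃ Z × K b) : K b →* Equiv.Perm W where
  toFun g :=
    { toFun := fun x => ε.symm ((ε x).1, g * (ε x).2)
      invFun := fun x => ε.symm ((ε x).1, g⁻¹ * (ε x).2)
      left_inv := fun x => by simp
      right_inv := fun x => by simp }
  map_one' := by ext x; simp
  map_mul' g h := by ext x; simp [mul_assoc]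

/-- Every vector in `typeMonoid K C` is realized by a labelled free `F`-set. -/
theorem exists_realization [MulAction F X₁] (hK : IsFreeProd K) {v : (Σ b, VType K C b) → ℕ}
    (hv : v ∈ typeMonoid K C) :
    ∃ (X₂ : Type) (_ : MulAction F X₂) (ℓ : X₂ → Option (Lab C)) (E : Finset X₂),
      FreeAct K X₂ ∧ (∀ x, x ∈ E ↔ ℓ x ≠ none) ∧ MinDegTwo K E ∧
      defect K E = weight baseCoeff v ∧ defect K (prodSet ℓ E) = weight prodCoeff v := by
  obtain ⟨e, he⟩ := exists_equiv_modelLab hv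
  let W : Type := (VIndex K C v true ⊕ ℕ) × K true
  let ε : ∀ b, W ≃ (VIndex K C v b ⊕ ℕ) × K b := fun b =>
    match b with
    | true => Equiv.refl _
    | false => e
  let ℓ : W → Option (Lab C) := modelLab v true
  have hℓ : ∀ b x, ℓ x = modelLab v b (ε b x) := fun b x =>
    match b with
    | true => rfl
    | false => (he x).symm
  obtain ⟨Φ, hΦ⟩ := hK.2 (Equiv.Perm W) fun b => translationHom (ε b)
  let _ : MulAction F W := MulAction.compHom W Φ
  have hsmul : ∀ b (g : K b) (x : W), (g : F) • x = (ε b).symm ((ε b x).1, g * (ε b x).2) := by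
    intro b g x
    change Φ g x = _
    rw [hΦ]
    rfl
  have hfree : FreeAct K W := by
    intro b g hg x h
    have h1 := hsmul b ⟨g, hg⟩ x
    rw [Equiv.eq_symm_apply] at h1
    simp only [h] at h1
    have h2 := congrArg Prod.snd h1
    exact congrArg Subtype.val (right_eq_mul.1 h2)
  have hsurj : ∀ x, ℓ x ≠ none → ∃ i g, x = (ε true).symm (Sum.inl i, g) := by
    rintro ⟨i | n, g⟩ h
    · exact ⟨i, g, rfl⟩
    · exact absurd rfl h
  have hfin : {x | ℓ x ≠ none}.Finite := by
    refine (Set.finite_range fun p : VIndex K C v true × K true =>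
      (ε true).symm (Sum.inl p.1, p.2)).subset fun x hx => ?_
    obtain ⟨i, g, rfl⟩ := hsurj x hx
    exact ⟨(i, g), rfl⟩
  have hE : ∀ x, x ∈ hfin.toFinset ↔ ℓ x ≠ none := fun x => by simp
  have hT : ∀ b, Transversal b ℓ (fun i : VIndex K C v b => (ε b).symm (Sum.inl i, 1))
      (fun i => i.1) := by
    intro b
    refine ⟨fun i g => ?_, fun i j h => ?_, fun x hx => ?_⟩
    · rw [hℓ b, hsmul]
      simp [modelLab]
    · obtain ⟨g, hg, h⟩ := orb_eq.1 h
      have h1 := hsmul b ⟨g, hg⟩ ((ε b).symm (Sum.inl j, 1))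
      simp only [h] at h1
      have h2 : i = j ∧ 1 = (⟨g, hg⟩ : K b) := by simpa using h1
      exact h2.1
    · rw [hℓ b] at hx
      obtain ⟨y, rfl⟩ := (ε b).symm.surjective x
      obtain ⟨i | n, g⟩ := y
      · exact ⟨i, orb_eq.2 ⟨g, g.2, by rw [hsmul]; simp⟩⟩
      · exact absurd (by simp [modelLab]) hx
  obtain ⟨-, h1, h2⟩ := weights_of_transversals hfree hE hT (v := v) fun b s => by
    rw [Nat.card_congr (Equiv.sigmaSubtype s), Nat.card_eq_fintype_card, Fintype.card_fin]
  exact ⟨W, _, ℓ, hfin.toFinset, hfree, hE, minDegTwo_of_transversals hfree hE hT, h1, h2⟩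

end Realization

section Extremal

variable {X₁ X₂ : Type} [MulAction F X₁] [MulAction F X₂] [∀ b, Fintype (K b)] {C : Finset X₁}

theorem defect_prodSet_le (hfree : FreeAct K X₂) {β γ : ℤ}
    (hmax : ∀ v ∈ typeMonoid K C, weight prodCoeff v * γ ≤ β * weight baseCoeff v)
    {ℓ : X₂ → Option (Lab C)} {E : Finset X₂} (hE : ∀ x ∈ E, ℓ x ≠ none) (htwo : MinDegTwo K E) :
    defect K (prodSet ℓ E) * γ ≤ β * defect K E := by
  have h1 : prodSet ℓ E = prodSet (fun x => if x ∈ E then ℓ x else none) E :=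
    Finset.biUnion_congr rfl fun x hx => by simp [hx]
  obtain ⟨v, hv, h2, h3⟩ := exists_weights (ℓ := fun x => if x ∈ E then ℓ x else none) (E := E)
    hfree (fun x => ⟨fun hx => by simpa [hx] using hE x hx, fun h => by
      by_contra hx
      simp [hx] at h⟩) htwo
  rw [h1, h2, h3]
  exact hmax v hv

theorem exists_goodLift_of_extremal (hfree : FreeAct K X₂) {β γ : ℤ}
    (hmax : ∀ v ∈ typeMonoid K C, weight prodCoeff v * γ ≤ β * weight baseCoeff v)
    {ℓ : X₂ → Option (Lab C)} {E : Finset X₂} (hE : ∀ x ∈ E, ℓ x ≠ none) (htwo : MinDegTwo K E)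
    (heq : defect K (prodSet ℓ E) * γ = β * defect K E) (hpos : 0 < defect K E) :
    ∃ (E' : Finset X₂) (x₀ : X₂) (L : Subgroup F), GoodLift K x₀ E' L ∧
      defect K (prodSet ℓ E') * γ = β * defect K E' ∧ 0 < defect K E' := by
  induction hn : E.card using Nat.strong_induction_on generalizing E with
  | _ n ih =>
    obtain ⟨x₀, hx₀⟩ : E.Nonempty := by
      rw [Finset.nonempty_iff_ne_empty]
      rintro rfl
      simp at hpos
    obtain ⟨D, hDE, hx₀D, hD, L, hL⟩ := exists_goodLift_component hfree hx₀
    have hRE : E \ D ⊆ E := Finset.sdiff_subset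
    have hDR : ∀ b, ∀ x ∈ D, ∀ y ∈ E \ D, orb K b x ≠ orb K b y := fun b x hx y hy h =>
      (Finset.mem_sdiff.1 hy).2 (hD b x hx y (hRE hy) h)
    have htwoD : MinDegTwo K D := fun b x hx => by
      obtain ⟨y, hy, hne, hyx⟩ := htwo b x (hDE hx)
      exact ⟨y, hD b x hx y hy hyx.symm, hne, hyx⟩
    have htwoR : MinDegTwo K (E \ D) := fun b x hx => by
      obtain ⟨y, hy, hne, hyx⟩ := htwo b x (hRE hx)
      exact ⟨y, Finset.mem_sdiff.2 ⟨hy, fun hyD => hDR b y hyD x hx hyx⟩, hne, hyx⟩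
    have hdef : defect K E = defect K D + defect K (E \ D) := by
      rw [← defect_union hDR, Finset.union_sdiff_of_subset hDE]
    have hprod : defect K (prodSet ℓ E) =
        defect K (prodSet ℓ D) + defect K (prodSet ℓ (E \ D)) := by
      rw [← defect_union]
      · congr 1
        ext y
        simp only [Finset.mem_union, mem_prodSet, Finset.mem_sdiff]
        constructor
        · rintro ⟨h1, h2⟩
          by_cases h : y.2 ∈ D
          · exact Or.inl ⟨h, h2⟩
          · exact Or.inr ⟨⟨h1, h⟩, h2⟩
        · rintro (⟨h1, h2⟩ | ⟨⟨h1, -⟩, h2⟩)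
          · exact ⟨hDE h1, h2⟩
          · exact ⟨h1, h2⟩
      · intro b x hx y hy h
        exact hDR b x.2 (mem_prodSet.1 hx).1 y.2 (mem_prodSet.1 hy).1
          (orb_map (φ := Prod.snd) (fun _ _ => rfl) h)
    have h1 := defect_prodSet_le hfree hmax (fun x hx => hE x (hDE hx)) htwoD
    have h2 := defect_prodSet_le hfree hmax (fun x hx => hE x (hRE hx)) htwoR
    rw [hdef, hprod, add_mul, mul_add] at heq
    by_cases hD0 : 0 < defect K D
    · exact ⟨D, x₀, L, hL, by linarith, hD0⟩
    · refine ih _ ?_ (fun x hx => hE x (hRE hx)) htwoR (by linarith) (by linarith) rfl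
      rw [← hn]
      exact Finset.card_lt_card
        ⟨hRE, fun h => (Finset.mem_sdiff.1 (h (hDE hx₀D))).2 hx₀D⟩

end Extremal

theorem card_image_le_card_image {α β γ : Type*} [DecidableEq β] [DecidableEq γ]
    {s : Finset α} {f : α → β} {g : α → γ}
    (h : ∀ x ∈ s, ∀ y ∈ s, g x = g y → f x = f y) : (s.image f).card ≤ (s.image g).card := by
  refine Finset.card_le_card_of_forall_subsingleton (fun a b => ∃ x ∈ s, f x = a ∧ g x = b) ?_ ?_
  · intro a ha
    obtain ⟨x, hx, rfl⟩ := Finset.mem_image.1 ha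
    exact ⟨g x, Finset.mem_image_of_mem g hx, x, hx, rfl, rfl⟩
  · rintro b - a ⟨-, x, hx, rfl, hxb⟩ a' ⟨-, y, hy, rfl, hyb⟩
    exact h x hx y hy (hxb.trans hyb.symm)

theorem defect_le_image [DecidableEq Y] {E : Finset X} {φ : X → Y} (hinj : Set.InjOn φ E)
    (h : ∀ b, ∀ x ∈ E, ∀ y ∈ E, orb K b x = orb K b y → orb K b (φ x) = orb K b (φ y)) :
    defect K E ≤ defect K (E.image φ) := by
  have h1 : ∀ b, orbCount K b (E.image φ) ≤ orbCount K b E := fun b => by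
    unfold orbCount
    rw [Finset.image_image]
    exact card_image_le_card_image (h b)
  have h2 := h1 true
  have h3 := h1 false
  unfold defect
  rw [Finset.card_image_of_injOn hinj]
  omega

section

variable {x₀ : X} {E : Finset X} {L : Subgroup F}

theorem PartialLift.injOn {p : X → F} (hp : PartialLift K x₀ E L p) :
    Set.InjOn (fun x => (QuotientGroup.mk (p x) : F ⧸ L)) E := by
  intro x hx y hy h
  have h1 := MulAction.mem_stabilizer_iff.1 (hp.le (QuotientGroup.eq.1 h))
  rw [mul_smul, inv_smul_eq_iff, hp.proj x hx, hp.proj y hy] at h1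
  exact h1.symm

theorem PartialLift.smul_mk {p : X → F} (hp : PartialLift K x₀ E L p) {b : Bool} {g : F}
    (hg : g ∈ K b) {x : X} (hx : x ∈ E) (hgx : g • x ∈ E) :
    g • (QuotientGroup.mk (p x) : F ⧸ L) = QuotientGroup.mk (p (g • x)) :=
  (QuotientGroup.eq.2 (hp.equivariant b g hg x hx hgx)).symm

theorem freeAct_quotient_of_le (hfree : FreeAct K X) (hL : L ≤ MulAction.stabilizer F x₀) :
    FreeAct K (F ⧸ L) := by
  intro b g hg q h
  obtain ⟨w, rfl⟩ := QuotientGroup.mk_surjective q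
  have h1 := MulAction.mem_stabilizer_iff.1 (hL (QuotientGroup.eq.1 h))
  refine hfree b g hg (w • x₀) ?_
  simp only [smul_eq_mul, mul_inv_rev, mul_smul, inv_smul_eq_iff] at h1
  exact h1.symm

theorem exists_smul_quotient_eq (H : Subgroup F) (x y : F ⧸ H) : ∃ w : F, w • x = y :=
  MulAction.exists_smul_eq F x y

theorem stabilizer_mk_one (H : Subgroup F) :
    MulAction.stabilizer F (QuotientGroup.mk 1 : F ⧸ H) = H :=
  MulAction.stabilizer_quotient H

theorem defect_le_rrk (hK : IsFreeProd K) {H : Subgroup F} (hfg : H.FG) (E : Finset (F ⧸ H)) :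
    defect K E ≤ rrk H := by
  have h := defect_le_rrk_stabilizer hK (x₀ := (QuotientGroup.mk 1 : F ⧸ H)) (E := E)
    (by rwa [stabilizer_mk_one]) fun x _ => exists_smul_quotient_eq H _ x
  rwa [stabilizer_mk_one] at h

theorem exists_isCore_quotient (hK : IsFreeProd K) {H : Subgroup F} (hfg : H.FG)
    (hfree : FreeAct K (F ⧸ H)) (hpos : 0 < rrk H) :
    ∃ C : Finset (F ⧸ H), IsCore K C ∧ defect K C = rrk H := by
  have hn := defect_le_rrk hK hfg
  obtain ⟨E, -, hE⟩ := exists_rrk_stabilizer_le_defect hK hfree hn (QuotientGroup.mk 1)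
  rw [stabilizer_mk_one] at hE
  obtain ⟨C, hC⟩ := exists_isCore hn (E₀ := E) (by omega)
  exact ⟨C, hC, le_antisymm (hn C) (hE.trans (hC.max E))⟩

theorem GoodLift.fg (hL : GoodLift K x₀ E L) : L.FG := by
  obtain ⟨-, S, hS, -⟩ := hL
  exact ⟨S, hS⟩

theorem GoodLift.rrk_eq (hK : IsFreeProd K) (hL : GoodLift K x₀ E L) (hpos : 0 < defect K E) :
    (rrk L : ℤ) = defect K E := by
  obtain ⟨⟨p, hp⟩, S, hS, hcard⟩ := hL
  refine le_antisymm ?_ ?_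
  · have := rk_le_card hS
    unfold rrk
    omega
  · refine le_trans (defect_le_image hp.injOn ?_) (defect_le_rrk hK ⟨S, hS⟩ _)
    intro b x hx y hy h
    obtain ⟨g, hg, rfl⟩ := orb_eq.1 h
    exact orb_eq.2 ⟨g, hg, hp.smul_mk hg hy hx⟩

theorem GoodLift.exists_defect_le (hL : GoodLift K x₀ E L) (P : Finset (Y × X))
    (hP : ∀ y ∈ P, y.2 ∈ E) : ∃ P' : Finset (Y × (F ⧸ L)), defect K P ≤ defect K P' := by
  obtain ⟨⟨p, hp⟩, -⟩ := hL
  refine ⟨_, defect_le_image (φ := fun y => (y.1, (QuotientGroup.mk (p y.2) : F ⧸ L))) ?_ ?_⟩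
  · intro x hx y hy h
    rw [Prod.mk.injEq] at h
    exact Prod.ext h.1 (hp.injOn (hP x hx) (hP y hy) h.2)
  · intro b x hx y hy h
    obtain ⟨g, hg, rfl⟩ := orb_eq.1 h
    exact orb_eq.2 ⟨g, hg, Prod.ext rfl (hp.smul_mk hg (hP y hy) (hP _ hx))⟩

end

theorem freeAct_prod_left (hfree : FreeAct K X) : FreeAct K (X × Y) :=
  fun b g hg x h => hfree b g hg x.1 (congrArg Prod.fst h)

section

variable [∀ b, Finite (K b)]

theorem defect_le_rrkInter_of_cores (hK : IsFreeProd K) {H₁ H₂ : Subgroup F}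
    (hfree₁ : FreeAct K (F ⧸ H₁)) (hfree₂ : FreeAct K (F ⧸ H₂)) {C₁ : Finset (F ⧸ H₁)}
    {C₂ : Finset (F ⧸ H₂)} (hC₁ : IsCore K C₁) (hC₂ : IsCore K C₂)
    (E : Finset ((F ⧸ H₁) × (F ⧸ H₂))) : defect K E ≤ rrkInter H₁ H₂ :=
  defect_le_rrkInter hK (freeAct_prod_left hfree₁)
    (defect_product_bounded hK.1 hfree₁ hfree₂ hC₁ hC₂ (exists_smul_quotient_eq H₁)
      (exists_smul_quotient_eq H₂)) E

theorem exists_subset_product_core_rrkInter_le (hK : IsFreeProd K) {H₁ H₂ : Subgroup F}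
    (hfree₁ : FreeAct K (F ⧸ H₁)) (hfree₂ : FreeAct K (F ⧸ H₂)) {C₁ : Finset (F ⧸ H₁)}
    {C₂ : Finset (F ⧸ H₂)} (hC₁ : IsCore K C₁) (hC₂ : IsCore K C₂) :
    ∃ E ⊆ C₁ ×ˢ C₂, (rrkInter H₁ H₂ : ℤ) ≤ defect K E := by
  obtain ⟨E, hE⟩ := exists_rrkInter_le_defect hK (freeAct_prod_left hfree₁)
    (defect_product_bounded hK.1 hfree₁ hfree₂ hC₁ hC₂ (exists_smul_quotient_eq H₁)
      (exists_smul_quotient_eq H₂))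
  obtain ⟨E', hE', h⟩ := exists_defect_le_product_core hK.1 hfree₁ hfree₂ hC₁ hC₂
    (exists_smul_quotient_eq H₁) (exists_smul_quotient_eq H₂) E
  exact ⟨E', hE', hE.trans h⟩

end

theorem exists_prodSet_eq {X₁ X₂ : Type} {C : Finset X₁} {E : Finset X₂} {P : Finset (X₁ × X₂)}
    (hP : P ⊆ C ×ˢ E) :
    ∃ ℓ : X₂ → Option (Lab C), (∀ x, x ∈ E ↔ ℓ x ≠ none) ∧ prodSet ℓ E = P := by
  refine ⟨fun x => if x ∈ E then
    some ⟨C.filter fun a => (a, x) ∈ P, Finset.mem_powerset.2 (Finset.filter_subset _ _)⟩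
    else none, fun x => by simp, ?_⟩
  ext ⟨a, x⟩
  rw [mem_prodSet]
  constructor
  · rintro ⟨hx, h⟩
    simp only [if_pos hx, labSet, Finset.mem_filter] at h
    exact h.2
  · intro h
    obtain ⟨ha, hx⟩ := Finset.mem_product.1 (hP h)
    refine ⟨hx, ?_⟩
    simp only [if_pos hx, labSet, Finset.mem_filter]
    exact ⟨ha, h⟩

theorem exists_extremal_subgroup [∀ b, Finite (K b)] (hK : IsFreeProd K) {H₁ : Subgroup F}
    (hfg : H₁.FG) (hfree : FreeAct K (F ⧸ H₁)) (hpos : 0 < rrk H₁) :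
    ∃ L : Subgroup F, L.FG ∧ FreeAct K (F ⧸ L) ∧ 0 < rrk L ∧
      ∀ H₂ : Subgroup F, H₂.FG → FreeAct K (F ⧸ H₂) → 0 < rrk H₂ →
        rrkInter H₁ H₂ * rrk L ≤ rrkInter H₁ L * rrk H₂ := by
  let _ : ∀ b, Fintype (K b) := fun b => Fintype.ofFinite (K b)
  obtain ⟨C, hC, hCd⟩ := exists_isCore_quotient hK hfg hfree hpos
  have hvec : ∀ H₂ : Subgroup F, H₂.FG → FreeAct K (F ⧸ H₂) → 0 < rrk H₂ →
      ∃ v ∈ typeMonoid K C, weight baseCoeff v = rrk H₂ ∧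
        (rrkInter H₁ H₂ : ℤ) ≤ weight prodCoeff v := by
    intro H₂ hfg₂ hfree₂ hpos₂
    obtain ⟨C₂, hC₂, hC₂d⟩ := exists_isCore_quotient hK hfg₂ hfree₂ hpos₂
    obtain ⟨P, hP, hle⟩ := exists_subset_product_core_rrkInter_le hK hfree hfree₂ hC hC₂
    obtain ⟨ℓ, hℓ, rfl⟩ := exists_prodSet_eq hP
    obtain ⟨v, hv, h1, h2⟩ := exists_weights hfree₂ hℓ hC₂.two
    exact ⟨v, hv, by rw [← h1, hC₂d], by rwa [← h2]⟩
  obtain ⟨u, hu, hγ, hmax⟩ := exists_max_ratio (typeMonoid_fg (K := K) (C := C))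
    (weight prodCoeff) (weight baseCoeff) (fun v => weight_baseCoeff_nonneg)
    (fun v => weight_prodCoeff_nonpos) (by
      obtain ⟨v, hv, h, -⟩ := hvec H₁ hfg hfree hpos
      exact ⟨v, hv, by rw [h]; exact_mod_cast hpos⟩)
  obtain ⟨X₂, _, ℓ, E, hfree₂, hE, htwo, hb, hp⟩ := exists_realization hK hu
  obtain ⟨E', x₀, L, hL, heq, hpos'⟩ := exists_goodLift_of_extremal hfree₂ hmax
    (fun x => (hE x).1) htwo (by rw [hb, hp]) (by rwa [hb])
  have hLr := hL.rrk_eq hK hpos'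
  have hLfree : FreeAct K (F ⧸ L) := by
    obtain ⟨⟨p, hp⟩, -⟩ := hL
    exact freeAct_quotient_of_le hfree₂ hp.le
  have hLpos : 0 < rrk L := by omega
  obtain ⟨C₂, hC₂, -⟩ := exists_isCore_quotient hK hL.fg hLfree hLpos
  obtain ⟨P', hP'⟩ := hL.exists_defect_le (prodSet ℓ E') fun y hy => (mem_prodSet.1 hy).1
  have hLI := hP'.trans (defect_le_rrkInter_of_cores hK hfree hLfree hC hC₂ P')
  refine ⟨L, hL.fg, hLfree, hLpos, fun H₂ hfg₂ hfree₂ hpos₂ => ?_⟩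
  obtain ⟨v, hv, h1, h2⟩ := hvec H₂ hfg₂ hfree₂ hpos₂
  have h3 := hmax v hv
  rw [h1] at h3
  rw [← hLr] at heq
  have h4 : (rrkInter H₁ H₂ : ℤ) * rrk L * weight baseCoeff u ≤
      rrkInter H₁ L * rrk H₂ * weight baseCoeff u := by
    calc _ = (rrkInter H₁ H₂ : ℤ) * weight baseCoeff u * rrk L := by ring
      _ ≤ weight prodCoeff v * weight baseCoeff u * rrk L := by gcongr
      _ ≤ weight prodCoeff u * rrk H₂ * rrk L := by gcongr
      _ = defect K (prodSet ℓ E') * weight baseCoeff u * rrk H₂ := by rw [heq]; ring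
      _ ≤ rrkInter H₁ L * weight baseCoeff u * rrk H₂ := by gcongr
      _ = _ := by ring
  exact_mod_cast le_of_mul_le_mul_right h4 hγ

end DefectTheory

section CoprodFactors

variable {G1 G2 : Type} [Group G1] [Group G2]

/-- The two factors of a free product. -/
def coprodFactor (G1 G2 : Type) [Group G1] [Group G2] : Bool → Subgroup (Coprod G1 G2)
  | true => (Coprod.inl : G1 →* Coprod G1 G2).range
  | false => (Coprod.inr : G2 →* Coprod G1 G2).range

theorem isFreeProd_coprodFactor : IsFreeProd (coprodFactor G1 G2) := by
  refine ⟨?_, fun P _ φ => ?_⟩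
  · rw [iSup_bool_eq]
    exact Coprod.range_inl_sup_range_inr
  · refine ⟨Coprod.lift ((φ true).comp (Coprod.inl : G1 →* Coprod G1 G2).rangeRestrict)
      ((φ false).comp (Coprod.inr : G2 →* Coprod G1 G2).rangeRestrict), fun b => ?_⟩
    cases b
    · rintro ⟨_, x, rfl⟩
      exact Coprod.lift_apply_inr _ _ x
    · rintro ⟨_, x, rfl⟩
      exact Coprod.lift_apply_inl _ _ x

theorem finite_coprodFactor [Finite G1] [Finite G2] (b : Bool) : Finite (coprodFactor G1 G2 b) :=
  match b with
  | true => Finite.of_surjective _ (Coprod.inl : G1 →* Coprod G1 G2).rangeRestrict_surjective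
  | false => Finite.of_surjective _ (Coprod.inr : G2 →* Coprod G1 G2).rangeRestrict_surjective

theorem freeAct_quotient_iff {F : Type} [Group F] {K : Bool → Subgroup F} {H : Subgroup F} :
    FreeAct K (F ⧸ H) ↔ ∀ b s, H ⊓ conjS s (K b) = ⊥ := by
  constructor
  · intro h b s
    rw [eq_bot_iff]
    rintro _ ⟨hH, g, hg, rfl⟩
    have h1 := h b g hg (QuotientGroup.mk s⁻¹) (QuotientGroup.eq.2 ?_)
    · simp [h1]
    · have := H.inv_mem hH
      simpa [mul_assoc] using this
  · intro h b g hg q hq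
    obtain ⟨w, rfl⟩ := QuotientGroup.mk_surjective q
    have h1 : w⁻¹ * g * w ∈ H ⊓ conjS w⁻¹ (K b) := by
      refine ⟨?_, g, hg, by simp⟩
      have := H.inv_mem (QuotientGroup.eq.1 hq)
      simpa [mul_assoc] using this
    rw [h b, Subgroup.mem_bot] at h1
    rw [show g = w * (w⁻¹ * g * w) * w⁻¹ by group, h1]
    simp

theorem factorFree2_iff {H : Subgroup (Coprod G1 G2)} :
    FactorFree2 H ↔ FreeAct (coprodFactor G1 G2) (Coprod G1 G2 ⧸ H) := by
  rw [freeAct_quotient_iff, Bool.forall_bool, ← forall_and]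
  exact forall_congr' fun s => and_comm

end CoprodFactors

/-- If `G1, G2` are nontrivial finite groups and `H1` is a finitely generated factor-free
noncyclic subgroup of `F = G1 ∗ G2`, then the supremum defining the WN-coefficient
`σ(H1)` is attained: there is a finitely generated factor-free noncyclic subgroup `H2*`
with `r̄(H1, H2*) = σ(H1)·r̄(H1)·r̄(H2*)`. -/
theorem statement1 {G1 G2 : Type} [Group G1] [Group G2]
    [Finite G1] [Finite G2] [Nontrivial G1] [Nontrivial G2]
    (H1 : Subgroup (Coprod G1 G2)) (h1fg : H1.FG) (h1ff : FactorFree2 H1)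
    (h1nc : Noncyclic H1) :
    ∃ H2 : Subgroup (Coprod G1 G2), H2.FG ∧ FactorFree2 H2 ∧ Noncyclic H2 ∧
      (rrkInter H1 H2 : ℝ) = sSup (wnSet H1) * (rrk H1 : ℝ) * (rrk H2 : ℝ) := by
  have := finite_coprodFactor (G1 := G1) (G2 := G2)
  have hpos := rrk_pos_of_noncyclic h1fg h1nc
  obtain ⟨L, hL, hLfree, hLpos, hmax⟩ := exists_extremal_subgroup isFreeProd_coprodFactor h1fg
    (factorFree2_iff.1 h1ff) hpos
  have hLff := factorFree2_iff.2 hLfree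
  have hLnc := noncyclic_of_rrk_pos hLpos
  have hgreatest : IsGreatest (wnSet H1) ((rrkInter H1 L : ℝ) / ((rrk H1 : ℝ) * (rrk L : ℝ))) := by
    refine ⟨⟨L, hL, hLff, hLnc, rfl⟩, ?_⟩
    rintro _ ⟨H2, h2fg, h2ff, h2nc, rfl⟩
    have h2pos := rrk_pos_of_noncyclic h2fg h2nc
    have h : (rrkInter H1 H2 : ℝ) * rrk L ≤ rrkInter H1 L * rrk H2 := by
      exact_mod_cast hmax H2 h2fg (factorFree2_iff.1 h2ff) h2pos
    rw [div_le_div_iff₀ (by positivity) (by positivity)]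
    calc (rrkInter H1 H2 : ℝ) * ((rrk H1 : ℝ) * rrk L) = rrk H1 * (rrkInter H1 H2 * rrk L) := by
          ring
      _ ≤ rrk H1 * (rrkInter H1 L * rrk H2) := by gcongr
      _ = _ := by ring
  refine ⟨L, hL, hLff, hLnc, ?_⟩
  rw [hgreatest.csSup_eq]
  have h1 : (rrk H1 : ℝ) ≠ 0 := by positivity
  have h2 : (rrk L : ℝ) ≠ 0 := by positivity
  field_simp
end

section
/- Let F = ∗_{α∈I} G_α be the free product of nontrivial groups G_α and let H1, H2 be finitely generated factor-free subgroups of F. Then the set of double cosets H1 t H2 (t ∈ F) such that H1 ∩ t H2 t⁻¹ ≠ {1} is finite, and for every t ∈ F the subgroup H1 ∩ t H2 t⁻¹ is finitely generated. -/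
open Monoid

section FreeProduct

variable {I : Type} {G : I → Type} [∀ i, Group (G i)]

/-- A subgroup of the free product `∗_{α∈I} G_α` is factor-free if it meets every
conjugate of every factor trivially. -/
def FactorFreeI (H : Subgroup (CoprodI G)) : Prop :=
  ∀ (s : CoprodI G) (i : I),
    H ⊓ conjS s (CoprodI.of : G i →* CoprodI G).range = ⊥

end FreeProduct

namespace FactorFree

open Relation Pointwise

section Paths

variable {I : Type} {G : I → Type} [∀ i, Group (G i)]

/-- The elements of the free product lying in one of the factors. -/
def IsFactor (g : CoprodI G) : Prop := g = 1 ∨ ∃ (i : I) (y : G i), g = CoprodI.of y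

theorem IsFactor.inv {g : CoprodI G} (h : IsFactor g) : IsFactor g⁻¹ := by
  rcases h with rfl | ⟨i, y, rfl⟩
  · exact Or.inl inv_one
  · exact Or.inr ⟨i, y⁻¹, (map_inv _ _).symm⟩

/-- `Joined Y a b` means that `b` can be reached from `a` inside `Y` by successive right
multiplications by elements of the factors. -/
def Joined (Y : Set (CoprodI G)) (a b : CoprodI G) : Prop :=
  a ∈ Y ∧ ReflTransGen (fun x y => y ∈ Y ∧ IsFactor (x⁻¹ * y)) a b

namespace Joined

variable {Y Z : Set (CoprodI G)} {a b c : CoprodI G}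

theorem refl (h : a ∈ Y) : Joined Y a a := ⟨h, .refl⟩

theorem left_mem (h : Joined Y a b) : a ∈ Y := h.1

theorem right_mem (h : Joined Y a b) : b ∈ Y := by
  obtain ⟨ha, h⟩ := h
  cases h with
  | refl => exact ha
  | tail _ h => exact h.1

theorem mono (hYZ : Y ⊆ Z) (h : Joined Y a b) : Joined Z a b :=
  ⟨hYZ h.1, ReflTransGen.mono (fun _ _ h' => ⟨hYZ h'.1, h'.2⟩) _ _ h.2⟩

theorem trans (h : Joined Y a b) (h' : Joined Y b c) : Joined Y a c :=
  ⟨h.1, h.2.trans h'.2⟩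

theorem step (h : Joined Y a b) (hc : c ∈ Y) (hbc : IsFactor (b⁻¹ * c)) : Joined Y a c :=
  ⟨h.1, h.2.tail ⟨hc, hbc⟩⟩

@[elab_as_elim]
theorem induction {motive : ∀ b, Joined Y a b → Prop} (h : Joined Y a b)
    (base : ∀ ha : a ∈ Y, motive a (refl ha))
    (step : ∀ x y (hx : Joined Y a x) (hy : y ∈ Y) (hxy : IsFactor (x⁻¹ * y)),
      motive x hx → motive y (hx.step hy hxy)) : motive b h := by
  obtain ⟨ha, h⟩ := h
  induction h with
  | refl => exact base ha
  | tail h h' ih => exact step _ _ ⟨ha, h⟩ h'.1 h'.2 ih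

theorem symm (h : Joined Y a b) : Joined Y b a := by
  induction h using Joined.induction with
  | base ha => exact refl ha
  | step x y hx hy hxy ih =>
    exact ((refl hy).step hx.right_mem (by simpa using hxy.inv)).trans ih

theorem smul (g : CoprodI G) (h : Joined Y a b) : Joined (g • Y) (g * a) (g * b) := by
  induction h using Joined.induction with
  | base ha => exact refl (Set.smul_mem_smul_set ha)
  | step x y hx hy hxy ih =>
    refine ih.step (Set.smul_mem_smul_set hy) ?_
    rwa [mul_inv_rev, mul_assoc, inv_mul_cancel_left]

end Joined

/-- The points that every path from `1` to `g` has to visit. -/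
def cutPoints (g : CoprodI G) : Set (CoprodI G) := {p | ∀ Y, Joined Y 1 g → p ∈ Y}

/-- The products of the suffixes of a reduced word. -/
def suffixProds (w : CoprodI.Word G) : Set (CoprodI G) :=
  {p | ∃ l, l <:+ w.toList ∧ p = (l.map fun x => CoprodI.of x.2).prod}

theorem suffixProds_finite (w : CoprodI.Word G) : (suffixProds w).Finite := by
  refine ((List.finite_toSet w.toList.tails).image
    fun l => (l.map fun x => (CoprodI.of x.2 : CoprodI G)).prod).subset ?_
  rintro p ⟨l, hl, rfl⟩
  exact ⟨l, by simpa using hl, rfl⟩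

theorem suffixProds_rcons [∀ i, DecidableEq (G i)] {i : I} (p : CoprodI.Word.Pair G i) :
    suffixProds p.tail ⊆ suffixProds (CoprodI.Word.rcons p) ∧
    suffixProds (CoprodI.Word.rcons p) ⊆
      insert (CoprodI.Word.rcons p).prod (suffixProds p.tail) := by
  unfold CoprodI.Word.rcons
  split_ifs with h
  · exact ⟨subset_rfl, Set.subset_insert _ _⟩
  · constructor
    · rintro _ ⟨l, hl, rfl⟩
      exact ⟨l, hl.trans (List.suffix_cons _ _), rfl⟩
    · rintro _ ⟨l, hl, rfl⟩
      rcases List.suffix_cons_iff.1 hl with rfl | hl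
      · exact Or.inl rfl
      · exact Or.inr ⟨l, hl, rfl⟩

theorem suffixProds_smul [DecidableEq I] [∀ i, DecidableEq (G i)] {i : I} (y : G i)
    (w : CoprodI.Word G) :
    suffixProds (CoprodI.of y • w) ⊆ insert (CoprodI.of y * w.prod) (suffixProds w) := by
  have h := suffixProds_rcons
    { CoprodI.Word.equivPair i w with head := y * (CoprodI.Word.equivPair i w).head }
  have h' := suffixProds_rcons (CoprodI.Word.equivPair i w)
  rw [← CoprodI.Word.equivPair_symm i (CoprodI.Word.equivPair i w), Equiv.symm_apply_apply] at h'
  rw [← CoprodI.Word.prod_smul, CoprodI.Word.of_smul_def]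
  exact h.2.trans (Set.insert_subset_insert h'.1)

theorem exists_finite_cutPoints (g : CoprodI G) :
    (cutPoints g).Finite ∧ ∀ p ∈ insert g (cutPoints g), Joined (cutPoints g) 1 p := by
  classical
  let P : CoprodI G → Set (CoprodI G) := fun g =>
    {p | p⁻¹ ∈ suffixProds (g⁻¹ • (CoprodI.Word.empty : CoprodI.Word G))}
  have hjoin : ∀ (g p), p ∈ P g → Joined (P g) 1 p := by
    rintro g p ⟨l, hl, hp⟩
    rw [inv_eq_iff_eq_inv] at hp
    subst hp
    induction l with
    | nil => simpa using Joined.refl (Y := P g) (a := 1) ⟨[], hl, by simp⟩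
    | cons x l ih =>
      refine (ih ((List.suffix_cons _ _).trans hl)).step ⟨_, hl, by simp⟩ ?_
      right
      exact ⟨x.1, x.2⁻¹, by simp⟩
  have hg : ∀ g, g ∈ P g := fun g =>
    ⟨_, List.suffix_rfl, by
      change g⁻¹ = (g⁻¹ • (CoprodI.Word.empty : CoprodI.Word G)).prod
      simp [CoprodI.Word.prod_smul]⟩
  have hsub : ∀ Y g, Joined Y 1 g → P g ⊆ Y := by
    intro Y g h
    induction h using Joined.induction with
    | base h1 =>
      rintro p ⟨l, hl, hp⟩
      have : l = [] := by simpa [CoprodI.Word.empty] using hl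
      subst this
      simp only [List.map_nil, List.prod_nil, inv_eq_one] at hp
      rwa [hp]
    | step x y hx hy hxy ih =>
      intro p hp
      rcases hxy with hxy | ⟨i, z, hxy⟩
      · rw [inv_mul_eq_one] at hxy
        subst hxy
        exact ih hp
      · have hy' : y⁻¹ = CoprodI.of z⁻¹ * x⁻¹ := by
          rw [map_inv, ← hxy]; group
        change p⁻¹ ∈ suffixProds _ at hp
        rw [hy', mul_smul] at hp
        rcases suffixProds_smul _ _ hp with hp | hp
        · rw [CoprodI.Word.prod_smul, CoprodI.Word.prod_empty, mul_one, ← hy', inv_inj] at hp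
          rwa [hp]
        · exact ih hp
  have hP : cutPoints g = P g :=
    subset_antisymm (fun p hp => hp _ (hjoin g g (hg g))) fun p hp Y hY => hsub Y g hY hp
  rw [hP, Set.insert_eq_of_mem (hg g)]
  exact ⟨(suffixProds_finite _).preimage inv_injective.injOn, hjoin g⟩

theorem cutPoints_finite (g : CoprodI G) : (cutPoints g).Finite := (exists_finite_cutPoints g).1

theorem joined_cutPoints_of_mem {g p : CoprodI G} (hp : p ∈ cutPoints g) :
    Joined (cutPoints g) 1 p := (exists_finite_cutPoints g).2 p (Or.inr hp)

theorem joined_cutPoints (g : CoprodI G) : Joined (cutPoints g) 1 g :=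
  (exists_finite_cutPoints g).2 g (Or.inl rfl)

/-- A set is connected if any two of its points are joined inside of it. -/
def Conn (Y : Set (CoprodI G)) : Prop := ∀ a ∈ Y, ∀ b ∈ Y, Joined Y a b

theorem Joined.cutPoints_subset {Y : Set (CoprodI G)} {a b : CoprodI G} (h : Joined Y a b) :
    a • cutPoints (a⁻¹ * b) ⊆ Y := by
  rintro _ ⟨p, hp, rfl⟩
  have := hp (a⁻¹ • Y) (by simpa using h.smul a⁻¹)
  simpa [Set.mem_inv_smul_set_iff] using this

theorem Conn.smul {Y : Set (CoprodI G)} (h : Conn Y) (g : CoprodI G) : Conn (g • Y) := by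
  rintro _ ⟨a, ha, rfl⟩ _ ⟨b, hb, rfl⟩
  exact (h a ha b hb).smul g

theorem Joined.of_cutPoints (a b : CoprodI G) : Joined (a • cutPoints (a⁻¹ * b)) a b := by
  simpa using (joined_cutPoints (a⁻¹ * b)).smul a

theorem Conn.inter {Y Z : Set (CoprodI G)} (hY : Conn Y) (hZ : Conn Z) : Conn (Y ∩ Z) :=
  fun a ha b hb => (Joined.of_cutPoints a b).mono <| Set.subset_inter
    (hY a ha.1 b hb.1).cutPoints_subset (hZ a ha.2 b hb.2).cutPoints_subset

theorem exists_conn_mul (H : Subgroup (CoprodI G)) (hH : H.FG) :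
    ∃ U : Set (CoprodI G), U.Finite ∧ 1 ∈ U ∧ Conn ((H : Set (CoprodI G)) * U) := by
  obtain ⟨S, rfl⟩ := hH
  refine ⟨⋃ s ∈ insert 1 (S : Set (CoprodI G)), cutPoints s, ?_, ?_, ?_⟩
  · exact (S.finite_toSet.insert 1).biUnion fun s _ => cutPoints_finite s
  · exact Set.mem_biUnion (Or.inl rfl) (joined_cutPoints _).left_mem
  set U := ⋃ s ∈ insert 1 (S : Set (CoprodI G)), cutPoints s with hU
  set H := Subgroup.closure (S : Set (CoprodI G))
  set C := (H : Set (CoprodI G)) * U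
  have htrans : ∀ h ∈ H, ∀ s ∈ insert 1 (S : Set (CoprodI G)), h • cutPoints s ⊆ C := by
    rintro h hh s hs _ ⟨p, hp, rfl⟩
    exact Set.mul_mem_mul hh (Set.mem_biUnion hs hp)
  have h1 : (1 : CoprodI G) ∈ C := by
    simpa using htrans 1 H.one_mem 1 (Or.inl rfl)
      (Set.smul_mem_smul_set (joined_cutPoints _).left_mem)
  have hmem : ∀ h ∈ H, Joined C 1 h := by
    intro h hh
    refine Subgroup.closure_induction_right (p := fun h _ => Joined C 1 h)
      (Joined.refl h1) ?_ ?_ hh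
    · intro x hx s hs ih
      have := ((joined_cutPoints s).smul x).mono (htrans x hx s (Or.inr hs))
      rw [mul_one] at this
      exact ih.trans this
    · intro x hx s hs ih
      have := ((joined_cutPoints s).smul (x * s⁻¹)).mono
        (htrans _ (H.mul_mem hx (H.inv_mem (Subgroup.subset_closure hs))) s (Or.inr hs))
      rw [mul_one, inv_mul_cancel_right] at this
      exact ih.trans this.symm
  have hall : ∀ c ∈ C, Joined C 1 c := by
    rintro _ ⟨h, hh, u, hu, rfl⟩
    obtain ⟨s, hs, hu⟩ := Set.mem_iUnion₂.1 hu
    have := ((joined_cutPoints_of_mem hu).smul h).mono (htrans h hh s hs)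
    rw [mul_one] at this
    exact (hmem h hh).trans this
  exact fun a ha b hb => (hall a ha).symm.trans (hall b hb)

end Paths

section Finiteness

variable {I : Type} {G : I → Type} [∀ i, Group (G i)]

open Classical in
/-- The projection of a free product onto one of its factors. -/
noncomputable def proj (i : I) : CoprodI G →* G i :=
  CoprodI.lift (Pi.mulSingle i (MonoidHom.id (G i)))

theorem proj_of_same {i : I} (y : G i) : proj i (CoprodI.of y) = y := by
  classical exact CoprodI.of_leftInverse i y

theorem proj_of_ne {i j : I} (h : j ≠ i) (y : G j) : proj i (CoprodI.of y) = 1 := by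
  classical simp [proj, Pi.mulSingle_eq_of_ne h]

theorem finite_proj_ne_one (g : CoprodI G) : {i | proj i g ≠ 1}.Finite := by
  induction g using CoprodI.induction_left with
  | one => simp
  | mul m x ih =>
    rename_i j
    refine (ih.insert j).subset fun i hi => ?_
    by_contra hi'
    simp only [Set.mem_insert_iff, Set.mem_ofPred_eq, not_or, not_not] at hi'
    exact hi (by rw [map_mul, proj_of_ne (Ne.symm hi'.1), hi'.2, one_mul])

theorem finite_exists_proj_ne_one {H : Subgroup (CoprodI G)} (hH : H.FG) :
    {i | ∃ h ∈ H, proj i h ≠ 1}.Finite := by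
  obtain ⟨S, rfl⟩ := hH
  refine (S.finite_toSet.biUnion fun s _ => finite_proj_ne_one s).subset ?_
  rintro i ⟨h, hh, hi⟩
  by_contra hcon
  refine hi ?_
  have : Subgroup.closure (S : Set (CoprodI G)) ≤ (proj i).ker := by
    rw [Subgroup.closure_le]
    intro s hs
    by_contra h
    exact hcon (Set.mem_biUnion hs h)
  exact this hh

theorem FactorFreeI.eq_one {H : Subgroup (CoprodI G)} (hH : FactorFreeI H) {h s : CoprodI G}
    (hh : h ∈ H) {i : I} {y : G i} (hy : s⁻¹ * h * s = CoprodI.of y) : h = 1 := by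
  have : h ∈ H ⊓ conjS s (CoprodI.of : G i →* CoprodI G).range := by
    refine ⟨hh, CoprodI.of y, ⟨y, rfl⟩, ?_⟩
    simp [← hy, mul_assoc]
  rwa [hH s i, Subgroup.mem_bot] at this

theorem finite_isFactor {H : Subgroup (CoprodI G)} (hfg : H.FG) (hH : FactorFreeI H)
    (p q : CoprodI G) : {k | k ∈ H ∧ IsFactor (p⁻¹ * k * q)}.Finite := by
  have hJ := ((finite_exists_proj_ne_one hfg).union (finite_proj_ne_one p)).union
    (finite_proj_ne_one q)
  refine ((hJ.biUnion (t := fun i => {k | k ∈ H ∧ ∃ y : G i, p⁻¹ * k * q = CoprodI.of y})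
    fun i _ => ?_).insert (p * q⁻¹)).subset ?_
  · refine Set.Subsingleton.finite ?_
    rintro k ⟨hk, y, hy⟩ k' ⟨hk', y', hy'⟩
    refine mul_inv_eq_one.1 (FactorFreeI.eq_one hH (s := p) (i := i) (y := y * y'⁻¹)
      (H.mul_mem hk (H.inv_mem hk')) ?_)
    rw [map_mul, map_inv, ← hy, ← hy']
    group
  · rintro k ⟨hk, h⟩
    have hone : p⁻¹ * k * q = 1 → k = p * q⁻¹ := fun h => by
      rw [mul_assoc, inv_mul_eq_one] at h
      rw [h, mul_inv_cancel_right]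
    rcases h with h | ⟨i, y, h⟩
    · exact Or.inl (hone h)
    by_cases hi : i ∈ ({i | ∃ h ∈ H, proj i h ≠ 1} ∪ {i | proj i p ≠ 1}) ∪ {i | proj i q ≠ 1}
    · exact Or.inr (Set.mem_biUnion hi ⟨hk, y, h⟩)
    · left
      apply hone
      simp only [Set.mem_union, Set.mem_ofPred_eq, not_or, not_exists, not_and, not_not] at hi
      have := congrArg (proj i) h
      rw [proj_of_same, map_mul, map_mul, map_inv, hi.1.1 k hk, hi.1.2, hi.2] at this
      rw [h, ← this]
      simp

theorem fg_of_cofinite_conn {H K : Subgroup (CoprodI G)} (hfg : H.FG) (hH : FactorFreeI H)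
    (hKH : K ≤ H) {X D : Set (CoprodI G)} (hX : Conn X) (hne : X.Nonempty)
    (hKX : ∀ k ∈ K, ∀ x ∈ X, k * x ∈ X) (hD : D.Finite)
    (hXD : X ⊆ (K : Set (CoprodI G)) * D) : K.FG := by
  obtain ⟨x₀, hx₀⟩ := hne
  set E := insert x₀ D
  have hE : E.Finite := hD.insert x₀
  set A : Set (CoprodI G) := ⋃ d ∈ E, ⋃ d' ∈ E, {k | k ∈ K ∧ IsFactor (d⁻¹ * k * d')}
  have hA : A.Finite := hE.biUnion fun d _ => hE.biUnion fun d' _ =>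
    (finite_isFactor hfg hH d d').subset fun k hk => ⟨hKH hk.1, hk.2⟩
  have hmemA : ∀ d ∈ E, ∀ d' ∈ E, ∀ k ∈ K, IsFactor (d⁻¹ * k * d') → k ∈ A :=
    fun d hd d' hd' k hk h => Set.mem_biUnion hd (Set.mem_biUnion hd' ⟨hk, h⟩)
  have key : ∀ c, Joined X x₀ c → ∀ k ∈ K, ∀ d ∈ E, c = k * d → k ∈ Subgroup.closure A := by
    intro c hc
    induction hc using Joined.induction with
    | base _ =>
      intro k hk d hd h
      exact Subgroup.subset_closure (hmemA x₀ (Or.inl rfl) d hd k hk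
        (Or.inl (by rw [mul_assoc, ← h, inv_mul_cancel])))
    | step x y hx hy hxy ih =>
      intro k hk d hd h
      obtain ⟨k', hk', d', hd', rfl⟩ := hXD hx.right_mem
      have h1 := ih k' hk' d' (Or.inr hd') rfl
      have h2 : k'⁻¹ * k ∈ A := by
        refine hmemA d' (Or.inr hd') d hd _ (K.mul_mem (K.inv_mem hk') hk) ?_
        rw [h] at hxy
        simpa [mul_assoc] using hxy
      simpa using Subgroup.mul_mem _ h1 (Subgroup.subset_closure h2)
  refine ⟨hA.toFinset, ?_⟩
  rw [hA.coe_toFinset]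
  refine le_antisymm ?_ fun k hk => key _ (hX x₀ hx₀ _ (hKX k hk x₀ hx₀)) k hk x₀ (Or.inl rfl) rfl
  rw [Subgroup.closure_le]
  intro k hk
  simp only [A, Set.mem_iUnion] at hk
  obtain ⟨_, _, _, _, hk⟩ := hk
  exact hk.1

theorem finite_of_disjoint {H K : Subgroup (CoprodI G)} (hfg : H.FG) (hH : FactorFreeI H)
    (hKH : K ≤ H) {C C' : Set (CoprodI G)} (hC : Conn C) (hC' : Conn C')
    (hKC : ∀ k ∈ K, ∀ x ∈ C, k * x ∈ C) (hKC' : ∀ k ∈ K, ∀ x ∈ C', k * x ∈ C')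
    {t : CoprodI G} (h1 : 1 ∈ C) (ht : t ∈ C') (hdisj : C ∩ C' = ∅) :
    (K : Set (CoprodI G)).Finite := by
  set Q := cutPoints t
  have hQ : Q.Finite := cutPoints_finite t
  refine (hQ.biUnion fun p _ => hQ.biUnion fun q _ => finite_isFactor hfg hH p q).subset ?_
  intro k hk
  have h1Q : (1 : CoprodI G) ∈ Q := (joined_cutPoints t).left_mem
  suffices ∃ p ∈ Q, ∃ q ∈ Q, IsFactor (p⁻¹ * k * q) by
    obtain ⟨p, hp, q, hq, h⟩ := this
    exact Set.mem_biUnion hp (Set.mem_biUnion hq ⟨hKH hk, h⟩)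
  have hkQ : Joined (k • Q) k (k * t) := by simpa using (joined_cutPoints t).smul k
  have hY : Joined (Q ∪ C' ∪ k • Q) 1 k := by
    refine (((joined_cutPoints t).mono ?_).trans
      ((hC' t ht (k * t) (hKC' k hk t ht)).mono ?_)).trans
      (hkQ.symm.mono ?_)
    · exact fun x hx => Or.inl (Or.inl hx)
    · exact fun x hx => Or.inl (Or.inr hx)
    · exact fun x hx => Or.inr hx
  have hsub : cutPoints k ⊆ Q ∪ k • Q := by
    intro p hp
    have hpC := hp C (hC 1 h1 k (by simpa using hKC k hk 1 h1))
    rcases hp _ hY with (h | h) | h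
    · exact Or.inl h
    · exact absurd (show p ∈ C ∩ C' from ⟨hpC, h⟩) (by simp [hdisj])
    · exact Or.inr h
  have key : ∀ c, Joined (Q ∪ k • Q) 1 c →
      c ∈ Q ∨ ∃ p ∈ Q, ∃ q ∈ Q, IsFactor (p⁻¹ * k * q) := by
    intro c hc
    induction hc using Joined.induction with
    | base _ => exact Or.inl h1Q
    | step x y hx hy hxy ih =>
      rcases ih with ih | ih
      · rcases hy with hy | ⟨q, hq, rfl⟩
        · exact Or.inl hy
        · exact Or.inr ⟨x, ih, q, hq, by simpa [mul_assoc] using hxy⟩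
      · exact Or.inr ih
  rcases key k ((joined_cutPoints k).mono hsub) with h | h
  · exact ⟨k, h, 1, h1Q, Or.inl (by simp)⟩
  · exact h

end Finiteness

section Torsion

variable {I : Type} {G : I → Type} [∀ i, Group (G i)]

theorem prod_pow_ne_one (n : ℕ) (L : List (Σ i, G i)) (hL : L.length = n)
    (h1 : (L.map fun x => (CoprodI.of x.2 : CoprodI G)).prod ≠ 1)
    (hconj : ∀ (s : CoprodI G) (i : I) (y : G i),
      s⁻¹ * (L.map fun x => (CoprodI.of x.2 : CoprodI G)).prod * s ≠ CoprodI.of y)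
    (m : ℕ) (hm : m ≠ 0) : (L.map fun x => (CoprodI.of x.2 : CoprodI G)).prod ^ m ≠ 1 := by
  induction n using Nat.strong_induction_on generalizing L with
  | _ n ih =>
  by_cases hone : ∀ x ∈ L, x.2 ≠ 1
  swap
  · push Not at hone
    obtain ⟨x, hx, hx1⟩ := hone
    obtain ⟨A, B, rfl⟩ := List.append_of_mem hx
    have heq : ((A ++ x :: B).map fun x => (CoprodI.of x.2 : CoprodI G)).prod
        = ((A ++ B).map fun x => (CoprodI.of x.2 : CoprodI G)).prod := by simp [hx1]
    rw [heq] at h1 hconj ⊢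
    exact ih _ (by simp [← hL]) _ rfl h1 hconj
  by_cases hchain : L.IsChain fun x y => x.1 ≠ y.1
  swap
  · rw [List.isChain_iff_forall_rel_of_append_cons_cons] at hchain
    push Not at hchain
    obtain ⟨⟨i, x⟩, ⟨j, y⟩, A, B, rfl, hij⟩ := hchain
    dsimp only at hij
    subst hij
    have heq : ((A ++ ⟨i, x⟩ :: ⟨i, y⟩ :: B).map fun x => (CoprodI.of x.2 : CoprodI G)).prod
        = ((A ++ ⟨i, x * y⟩ :: B).map fun x => (CoprodI.of x.2 : CoprodI G)).prod := by
      simp [mul_assoc]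
    rw [heq] at h1 hconj ⊢
    exact ih _ (by simp [← hL]) _ rfl h1 hconj
  have hne : L ≠ [] := by
    rintro rfl
    simp at h1
  by_cases hcyc : ∀ x ∈ L.getLast?, ∀ y ∈ L.head?, x.1 ≠ y.1
  · let w : CoprodI.Word G := ⟨(List.replicate m L).flatten, by
      intro l hl
      obtain ⟨L', hL', hl⟩ := List.mem_flatten.1 hl
      rw [List.eq_of_mem_replicate hL'] at hl
      exact hone l hl, by
      rw [List.isChain_flatten (by simp [Ne.symm hne])]
      refine ⟨fun l hl => by rwa [List.eq_of_mem_replicate hl], ?_⟩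
      exact List.isChain_replicate_of_rel m hcyc⟩
    have hw : w.prod = (L.map fun x => (CoprodI.of x.2 : CoprodI G)).prod ^ m := by
      simp [w, CoprodI.Word.prod, List.map_flatten, List.prod_flatten]
    rw [← hw]
    intro h
    classical
    have : w = CoprodI.Word.empty := CoprodI.Word.equiv.symm.injective h
    have := congrArg CoprodI.Word.toList this
    simp [w, CoprodI.Word.empty, hm, hne] at this
  · push Not at hcyc
    obtain ⟨⟨i, x⟩, hx, ⟨j, y⟩, hy, hij⟩ := hcyc
    dsimp only at hij
    subst hij
    obtain ⟨M, rfl⟩ : ∃ M, L = ⟨i, y⟩ :: M := by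
      cases L with
      | nil => simp at hy
      | cons a M => exact ⟨M, by simp_all⟩
    rcases List.eq_nil_or_concat M with rfl | ⟨N, a, rfl⟩
    · exact absurd (by simp) (hconj 1 i y)
    · obtain rfl : a = ⟨i, x⟩ := by simpa [List.getLast?_cons] using hx
      have heq : ((⟨i, y⟩ :: N.concat ⟨i, x⟩ : List (Σ i, G i)).map
            fun x => (CoprodI.of x.2 : CoprodI G)).prod
          = CoprodI.of y * ((N ++ [⟨i, x * y⟩] : List (Σ i, G i)).map
            fun x => (CoprodI.of x.2 : CoprodI G)).prod * (CoprodI.of y)⁻¹ := by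
        simp [mul_assoc]
      rw [heq] at h1 hconj ⊢
      rw [ne_eq, conj_eq_one_iff] at h1
      rw [conj_pow, ne_eq, conj_eq_one_iff]
      refine ih (N.length + 1) (by simp [← hL]) _ (by simp) h1 fun s j z => ?_
      have := hconj (CoprodI.of y * s) j z
      simpa [mul_assoc] using this

theorem eq_bot_of_finite {K : Subgroup (CoprodI G)} (hK : FactorFreeI K)
    (hfin : (K : Set (CoprodI G)).Finite) : K = ⊥ := by
  rw [Subgroup.eq_bot_iff_forall]
  intro k hk
  by_contra hk1
  have : Finite K := hfin
  have ho := isOfFinOrder_of_finite (⟨k, hk⟩ : K)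
  obtain ⟨m, hm, hpow⟩ := isOfFinOrder_iff_pow_eq_one.1 ho
  classical
  set w := CoprodI.Word.equiv k
  have hw : (w.toList.map fun x => (CoprodI.of x.2 : CoprodI G)).prod = k :=
    CoprodI.Word.equiv.symm_apply_apply k
  refine prod_pow_ne_one _ w.toList rfl ?_ ?_ m hm.ne' ?_
  · rwa [hw]
  · intro s i y h
    rw [hw] at h
    exact hk1 (FactorFreeI.eq_one hK hk h)
  · rw [hw]
    simpa using congrArg Subtype.val hpow

end Torsion

end FactorFree

open FactorFree Pointwise

/-- If `H1, H2` are finitely generated factor-free subgroups of the free product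
`F = ∗_{α∈I} G_α` of nontrivial groups, then the set of double cosets `H1 t H2` with
`H1 ∩ t H2 t⁻¹ ≠ {1}` is finite, and every subgroup `H1 ∩ t H2 t⁻¹` is finitely
generated. -/
theorem statement9 {I : Type} {G : I → Type} [∀ i, Group (G i)]
    [∀ i, Nontrivial (G i)]
    (H1 H2 : Subgroup (CoprodI G)) (h1fg : H1.FG) (h2fg : H2.FG)
    (h1ff : FactorFreeI H1) (h2ff : FactorFreeI H2) :
    {q : Quotient (dcSetoid H1 H2) | ∃ t : CoprodI G,
        Quotient.mk (dcSetoid H1 H2) t = q ∧ H1 ⊓ conjS t H2 ≠ ⊥}.Finite ∧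
    ∀ t : CoprodI G, (H1 ⊓ conjS t H2).FG := by
  obtain ⟨U1, hU1, h1U1, hC1⟩ := exists_conn_mul H1 h1fg
  obtain ⟨U2, hU2, h1U2, hC2⟩ := exists_conn_mul H2 h2fg
  set C1 := (H1 : Set (CoprodI G)) * U1
  set C2 := (H2 : Set (CoprodI G)) * U2
  have h1C1 : 1 ∈ C1 := ⟨1, H1.one_mem, 1, h1U1, one_mul 1⟩
  have h1C2 : 1 ∈ C2 := ⟨1, H2.one_mem, 1, h1U2, one_mul 1⟩
  have hinv1 : ∀ t, ∀ k ∈ H1 ⊓ conjS t H2, ∀ x ∈ C1, k * x ∈ C1 := by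
    rintro t k hk _ ⟨h, hh, u, hu, rfl⟩
    exact ⟨k * h, H1.mul_mem hk.1 hh, u, hu, mul_assoc _ _ _⟩
  have hinv2 : ∀ t, ∀ k ∈ H1 ⊓ conjS t H2, ∀ x ∈ t • C2, k * x ∈ t • C2 := by
    rintro t _ ⟨-, g, hg, rfl⟩ _ ⟨_, ⟨h, hh, u, hu, rfl⟩, rfl⟩
    exact ⟨g * h * u, ⟨g * h, H2.mul_mem hg hh, u, hu, rfl⟩, by simp [mul_assoc]⟩
  have hff : ∀ t, FactorFreeI (H1 ⊓ conjS t H2) := fun t s i =>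
    le_bot_iff.1 ((inf_le_inf_right _ inf_le_left).trans (h1ff s i).le)
  have hempty : ∀ t, C1 ∩ t • C2 = ∅ → H1 ⊓ conjS t H2 = ⊥ := fun t ht =>
    eq_bot_of_finite (hff t) (finite_of_disjoint h1fg h1ff inf_le_left hC1 (hC2.smul t)
      (hinv1 t) (hinv2 t) h1C1 (t := t) ⟨1, h1C2, mul_one t⟩ ht)
  constructor
  · refine ((hU1.prod hU2).image
      fun p => Quotient.mk (dcSetoid H1 H2) (p.1 * p.2⁻¹)).subset ?_
    rintro _ ⟨t, rfl, ht⟩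
    obtain ⟨_, ⟨h, hh, u, hu, rfl⟩, ⟨_, ⟨g, hg, v, hv, rfl⟩, hx⟩⟩ :=
      Set.nonempty_iff_ne_empty.2 fun h => ht (hempty t h)
    refine ⟨(u, v), ⟨hu, hv⟩, Quotient.sound ⟨h, hh, g⁻¹, H2.inv_mem hg, ?_⟩⟩
    have hx' : t * (g * v) = h * u := hx
    rw [← mul_assoc h, ← hx']
    group
  · intro t
    rcases (C1 ∩ t • C2).eq_empty_or_nonempty with he | hne
    · rw [hempty t he]
      exact ⟨∅, by simp⟩
    let R : CoprodI G → CoprodI G × CoprodI G → Prop := fun x p =>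
      (∃ h ∈ H1, x = h * p.1) ∧ ∃ g ∈ H2, x = t * g * p.2
    classical
    let rep : CoprodI G × CoprodI G → CoprodI G := fun p =>
      if h : ∃ x, R x p then h.choose else 1
    refine fg_of_cofinite_conn h1fg h1ff inf_le_left (hC1.inter (hC2.smul t)) hne
      (fun k hk x hx => ⟨hinv1 t k hk x hx.1, hinv2 t k hk x hx.2⟩)
      ((hU1.prod hU2).image rep) ?_
    rintro x ⟨⟨h, hh, u, hu, hx⟩, ⟨_, ⟨g, hg, v, hv, rfl⟩, hx'⟩⟩
    have hex : ∃ x, R x (u, v) :=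
      ⟨x, ⟨h, hh, hx.symm⟩, g, hg, by rw [← hx']; simp [mul_assoc]⟩
    have hrep : R (rep (u, v)) (u, v) := by
      simp only [rep, dif_pos hex]
      exact hex.choose_spec
    obtain ⟨⟨h', hh', e1⟩, g', hg', e2⟩ := hrep
    refine ⟨x * (rep (u, v))⁻¹, ⟨?_, g * g'⁻¹, H2.mul_mem hg (H2.inv_mem hg'), ?_⟩, _,
      ⟨(u, v), ⟨hu, hv⟩, rfl⟩, inv_mul_cancel_right _ _⟩
    · rw [e1, ← hx]
      simpa [mul_assoc] using H1.mul_mem hh (H1.inv_mem hh')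
    · rw [e2, ← hx']
      simp [mul_assoc]
end
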